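/- arXiv:math/0310285 — 2 statements merged into one kernel-verified Lean document; each statement's English description precedes it below -/
import Mathlib

section
/- Euler–Maclaurin analogue for the divisor function (Theorem 1(II)): Let R ≥ 0 be an integer, let a, b be real numbers with 0 ≤ a < b and a, b ∉ ℤ, and let f : ℝ → ℂ have continuous derivatives up to order R + 1 on [a,b]. Then all the symmetric series below converge and Σ_{a < n ≤ b} d(n) f(n) = ( Σ_{1 ≤ m ≤ b} 1/m ) ∫_a^b f(u) du + Σ_{r=0}^{R} (−1)^r · { f^{(r)}(b) · Σ′_n (1/(2πin)^{r+1}) ( Σ_{1 ≤ m ≤ b} m^r e^{2πinb/m} ) − f^{(r)}(a) · Σ′_n (1/(2πin)^{r+1}) ( Σ_{1 ≤ m ≤ b} m^r e^{2πina/m} ) } + (−1)^{R+1} · Σ′_n (1/(2πin)^{R+1}) ∫_a^b f^{(R+1)}(u) ( Σ_{1 ≤ m ≤ b} m^R e^{2πinu/m} ) du. -/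
open MeasureTheory intervalIntegral Filter

/-- `e(z) = exp(2πiz)`. -/
noncomputable def ee (z : ℂ) : ℂ := Complex.exp (2 * (Real.pi : ℂ) * Complex.I * z)

/-- `2πin`. -/
noncomputable def twoPiI (n : ℤ) : ℂ := 2 * (Real.pi : ℂ) * Complex.I * (n : ℂ)

/-- The symmetric limit `lim_{N→∞} ∑_{1 ≤ |n| ≤ N} g n = L` over nonzero integers. -/
def SymTendsto (g : ℤ → ℂ) (L : ℂ) : Prop :=
  Tendsto (fun N : ℕ => ∑ n ∈ (Finset.Icc (-(N : ℤ)) (N : ℤ)).erase 0, g n) atTop (nhds L)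

/-- The sawtooth function `1/2 - {x}`. -/
noncomputable def sawtooth (x : ℝ) : ℝ := 1 / 2 - Int.fract x

/-- The partial sums `∑_{1 ≤ n ≤ N} sin(2πnx) / (πn)` of the Fourier series of `sawtooth`. -/
noncomputable def sawtoothSum (N : ℕ) (x : ℝ) : ℝ :=
  ∑ k ∈ Finset.range N, Real.sin (2 * Real.pi * (k + 1) * x) / (Real.pi * (k + 1))

lemma sawtoothSum_one_sub (N : ℕ) (x : ℝ) : sawtoothSum N (1 - x) = -sawtoothSum N x := by
  unfold sawtoothSum
  rw [← Finset.sum_neg_distrib]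
  refine Finset.sum_congr rfl fun k _ => ?_
  have h : 2 * Real.pi * (k + 1) * (1 - x)
      = ((k + 1 : ℕ) : ℝ) * (2 * Real.pi) - 2 * Real.pi * (k + 1) * x := by
    push_cast; ring
  rw [h, Real.sin_nat_mul_two_pi_sub, neg_div]

lemma sawtoothSum_fract (N : ℕ) (x : ℝ) : sawtoothSum N (Int.fract x) = sawtoothSum N x := by
  unfold sawtoothSum
  refine Finset.sum_congr rfl fun k _ => ?_
  have h : 2 * Real.pi * (k + 1) * Int.fract x
      = 2 * Real.pi * (k + 1) * x - (((k + 1 : ℤ) * ⌊x⌋ : ℤ) : ℝ) * (2 * Real.pi) := by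
    rw [Int.fract]; push_cast; ring
  rw [h, Real.sin_sub_int_mul_two_pi]

lemma sawtoothSum_half (N : ℕ) : sawtoothSum N (1 / 2) = 0 := by
  have h := sawtoothSum_one_sub N (1 / 2)
  norm_num at h ⊢
  linarith

lemma abs_sawtoothSum_le_mul (N : ℕ) {x : ℝ} (hx : 0 ≤ x) : |sawtoothSum N x| ≤ 2 * N * x := by
  unfold sawtoothSum
  calc _ ≤ ∑ k ∈ Finset.range N, |Real.sin (2 * Real.pi * (k + 1) * x) / (Real.pi * (k + 1))| :=
        Finset.abs_sum_le_sum_abs _ _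
    _ ≤ ∑ k ∈ Finset.range N, 2 * x := by
        refine Finset.sum_le_sum fun k _ => ?_
        have hk : 0 < Real.pi * ((k : ℝ) + 1) := by positivity
        rw [abs_div, abs_of_pos hk, div_le_iff₀ hk]
        refine Real.abs_sin_le_abs.trans ?_
        rw [abs_of_nonneg (by positivity)]
        linarith
    _ = 2 * N * x := by simp; ring

lemma sin_mul_dirichlet_kernel (N : ℕ) (x : ℝ) :
    Real.sin (Real.pi * x) * (1 + ∑ k ∈ Finset.range N, 2 * Real.cos (2 * Real.pi * (k + 1) * x))
      = Real.sin ((2 * N + 1) * Real.pi * x) := by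
  induction N with
  | zero => simp
  | succ N ih =>
    rw [Finset.sum_range_succ, ← add_assoc, mul_add, ih]
    have h1 : (2 * ((N + 1 : ℕ) : ℝ) + 1) * Real.pi * x
        = 2 * Real.pi * (N + 1) * x + Real.pi * x := by push_cast; ring
    have h2 : (2 * (N : ℝ) + 1) * Real.pi * x
        = 2 * Real.pi * (N + 1) * x - Real.pi * x := by ring
    rw [h1, h2, Real.sin_add, Real.sin_sub]
    ring

lemma hasDerivAt_sawtoothSum (N : ℕ) (x : ℝ) :
    HasDerivAt (sawtoothSum N)
      (∑ k ∈ Finset.range N, 2 * Real.cos (2 * Real.pi * (k + 1) * x)) x := by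
  unfold sawtoothSum
  refine HasDerivAt.fun_sum fun k _ => ?_
  have h := ((hasDerivAt_id x).const_mul (2 * Real.pi * ((k : ℝ) + 1))).sin.div_const
    (Real.pi * (k + 1))
  refine h.congr_deriv ?_
  have : (k : ℝ) + 1 ≠ 0 := by positivity
  simp only [id]
  field_simp

lemma abs_sawtoothSum_sub_le_of_half_le (N : ℕ) {x : ℝ} (hx : 1 / 2 ≤ x) (hx1 : x < 1) :
    |sawtoothSum N x - (1 / 2 - x)| ≤ 2 / ((2 * N + 1) * Real.pi * Real.sin (Real.pi * x)) := by
  set l : ℝ := (2 * N + 1) * Real.pi with hl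
  have hlpos : 0 < l := by positivity
  have hsin : ∀ t ∈ Set.Icc (1 / 2) x, 0 < Real.sin (Real.pi * t) := fun t ht =>
    Real.sin_pos_of_pos_of_lt_pi (by have := ht.1; positivity)
      (by nlinarith [Real.pi_pos, ht.2])
  have hcos : ∀ t ∈ Set.Icc (1 / 2) x, Real.cos (Real.pi * t) ≤ 0 := fun t ht =>
    Real.cos_nonpos_of_pi_div_two_le_of_le (by nlinarith [Real.pi_pos, ht.1])
      (by nlinarith [Real.pi_pos, ht.2])
  let G : ℝ → ℝ := fun t =>
    sawtoothSum N t - (1 / 2 - t) + Real.cos (l * t) / (l * Real.sin (Real.pi * t))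
  let G' : ℝ → ℝ := fun t =>
    -(Real.pi * Real.cos (l * t) * Real.cos (Real.pi * t)) / (l * Real.sin (Real.pi * t) ^ 2)
  let B : ℝ → ℝ := fun t => 1 / (l * Real.sin (Real.pi * t)) - 1 / l
  let B' : ℝ → ℝ := fun t =>
    -(Real.pi * Real.cos (Real.pi * t)) / (l * Real.sin (Real.pi * t) ^ 2)
  have hden : ∀ t, HasDerivAt (fun t => l * Real.sin (Real.pi * t))
      (l * (Real.cos (Real.pi * t) * Real.pi)) t := fun t => by
    have h := (((hasDerivAt_id t).const_mul Real.pi).sin).const_mul l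
    simpa using h
  have hG : ∀ t ∈ Set.Icc (1 / 2) x, HasDerivAt G (G' t) t := by
    intro t ht
    have hs := hsin t ht
    have h1 : HasDerivAt (fun t => Real.cos (l * t)) (-Real.sin (l * t) * l) t := by
      simpa using ((hasDerivAt_id t).const_mul l).cos
    have h2 := ((hasDerivAt_sawtoothSum N t).sub ((hasDerivAt_id t).const_sub (1 / 2))).add
      (h1.div (hden t) (by positivity))
    refine h2.congr_deriv ?_
    have hk := sin_mul_dirichlet_kernel N t
    rw [← hl] at hk
    simp only [G']
    rw [← hk]
    generalize ∑ k ∈ Finset.range N, 2 * Real.cos (2 * Real.pi * (k + 1) * t) = S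
    field_simp
    ring
  have hB : ∀ t ∈ Set.Icc (1 / 2) x, HasDerivAt B (B' t) t := by
    intro t ht
    have hs := hsin t ht
    have h2 := ((hasDerivAt_const t (1 : ℝ)).div (hden t) (by positivity)).sub_const (1 / l)
    refine h2.congr_deriv ?_
    simp only [B']
    field_simp
    ring
  have hGB : ‖G (1 / 2)‖ ≤ B (1 / 2) := by
    have e1 : l * (1 / 2) = Real.pi / 2 + N * Real.pi := by rw [hl]; ring
    have e2 : Real.pi * (1 / 2) = Real.pi / 2 := by ring
    have e3 : Real.cos (Real.pi / 2 + N * Real.pi) = 0 := by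
      rw [Real.cos_add_nat_mul_pi]; simp
    simp only [G, B, e1, e2, e3, sawtoothSum_half]
    simp
  have key := image_norm_le_of_norm_deriv_right_le_deriv_boundary' (f := G) (f' := G')
    (a := 1 / 2) (b := x) (B := B) (B' := B')
    (fun t ht => (hG t ht).continuousAt.continuousWithinAt)
    (fun t ht => (hG t ⟨ht.1, ht.2.le⟩).hasDerivWithinAt) hGB
    (fun t ht => (hB t ht).continuousAt.continuousWithinAt)
    (fun t ht => (hB t ⟨ht.1, ht.2.le⟩).hasDerivWithinAt)
    (fun t ht => by
      have ht' : t ∈ Set.Icc (1 / 2) x := ⟨ht.1, ht.2.le⟩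
      have hs := hsin t ht'
      have hc := hcos t ht'
      simp only [G', B', norm_div, norm_neg, norm_mul, Real.norm_eq_abs]
      rw [abs_of_pos Real.pi_pos, abs_of_pos hlpos, abs_of_pos (by positivity : 0 <
        |Real.sin (Real.pi * t) ^ 2|) |>.symm, abs_abs,
        abs_of_pos (by positivity : 0 < Real.sin (Real.pi * t) ^ 2), abs_of_nonpos hc]
      refine div_le_div_of_nonneg_right ?_ (by positivity)
      have := Real.abs_cos_le_one (l * t)
      have h0 : 0 ≤ Real.pi * -Real.cos (Real.pi * t) :=
        mul_nonneg Real.pi_pos.le (by linarith)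
      nlinarith)
    (Set.right_mem_Icc.2 hx)
  have hs := hsin x (Set.right_mem_Icc.2 hx)
  have hcosb : |Real.cos (l * x) / (l * Real.sin (Real.pi * x))|
      ≤ 1 / (l * Real.sin (Real.pi * x)) := by
    rw [abs_div, abs_of_pos (by positivity : 0 < l * Real.sin (Real.pi * x))]
    gcongr
    exact Real.abs_cos_le_one _
  have hinv : 0 < 1 / l := by positivity
  simp only [G, B, Real.norm_eq_abs] at key
  rw [abs_le] at key hcosb ⊢
  have h2 : 2 / (l * Real.sin (Real.pi * x)) = 2 * (1 / (l * Real.sin (Real.pi * x))) := by ring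
  rw [h2]
  constructor <;> linarith [key.1, key.2, hcosb.1, hcosb.2]

lemma abs_sawtoothSum_sub_le (N : ℕ) {x : ℝ} (hx : 0 < x) (hx1 : x < 1) :
    |sawtoothSum N x - (1 / 2 - x)| ≤ 2 / ((2 * N + 1) * Real.pi * Real.sin (Real.pi * x)) := by
  rcases le_total (1 / 2) x with h | h
  · exact abs_sawtoothSum_sub_le_of_half_le N h hx1
  · have h1 := abs_sawtoothSum_sub_le_of_half_le N (x := 1 - x) (by linarith) (by linarith)
    have e : Real.pi * (1 - x) = Real.pi - Real.pi * x := by ring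
    rw [sawtoothSum_one_sub, e, Real.sin_pi_sub] at h1
    rw [← abs_neg]
    convert h1 using 2
    ring

lemma tendsto_sawtoothSum {x : ℝ} (hx : ∀ n : ℤ, x ≠ n) :
    Tendsto (fun N => sawtoothSum N x) atTop (nhds (sawtooth x)) := by
  have h0 : 0 < Int.fract x := (Int.fract_nonneg x).lt_of_ne' fun h => by
    have := Int.self_sub_floor x
    rw [h] at this
    exact hx ⌊x⌋ (by linarith)
  have h1 := Int.fract_lt_one x
  have hs : 0 < Real.sin (Real.pi * Int.fract x) :=
    Real.sin_pos_of_pos_of_lt_pi (by positivity) (by nlinarith [Real.pi_pos])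
  rw [tendsto_iff_norm_sub_tendsto_zero]
  refine squeeze_zero (fun _ => norm_nonneg _) (fun N => ?_)
    (g := fun N : ℕ => 2 / (Real.pi * Real.sin (Real.pi * Int.fract x)) * (1 / ((N : ℝ) + 1))) ?_
  · rw [← sawtoothSum_fract]
    refine (abs_sawtoothSum_sub_le N h0 h1).trans ?_
    rw [← div_eq_mul_one_div, div_div]
    refine div_le_div_of_nonneg_left (by norm_num) (by positivity) ?_
    nlinarith [mul_nonneg (mul_pos Real.pi_pos hs).le (Nat.cast_nonneg (α := ℝ) N)]
  · simpa using tendsto_one_div_add_atTop_nhds_zero_nat.const_mul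
      (2 / (Real.pi * Real.sin (Real.pi * Int.fract x)))

lemma abs_sawtoothSum_le (N : ℕ) (x : ℝ) : |sawtoothSum N x| ≤ 2 := by
  have main : ∀ y : ℝ, 0 ≤ y → y ≤ 1 / 2 → |sawtoothSum N y| ≤ 2 := by
    intro y hy hy2
    rcases le_total ((2 * N + 1) * y) 1 with h | h
    · refine (abs_sawtoothSum_le_mul N hy).trans ?_
      linarith
    · have hy0 : 0 < y := hy.lt_of_ne fun h0 => by rw [← h0] at h; norm_num at h
      have h1 := abs_sawtoothSum_sub_le N hy0 (by linarith)
      have hs : 2 * y ≤ Real.sin (Real.pi * y) := by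
        have := Real.mul_le_sin (x := Real.pi * y) (by positivity) (by nlinarith [Real.pi_pos])
        convert this using 1
        field_simp
      have h2 : 2 / ((2 * N + 1) * Real.pi * Real.sin (Real.pi * y)) ≤ 1 := by
        rw [div_le_one (by have : 0 < Real.sin (Real.pi * y) := by linarith
                           positivity)]
        calc (2 : ℝ) ≤ ((2 * N + 1) * y) * (2 * Real.pi) := by nlinarith [Real.pi_gt_three]
          _ = (2 * N + 1) * Real.pi * (2 * y) := by ring
          _ ≤ _ := by gcongr
      have h3 := h1.trans h2
      rw [abs_le] at h3 ⊢
      constructor <;> linarith [h3.1, h3.2]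
  rw [← sawtoothSum_fract]
  have h0 := Int.fract_nonneg x
  have h1 := Int.fract_lt_one x
  rcases le_total (Int.fract x) (1 / 2) with h | h
  · exact main _ h0 h
  · rw [← abs_neg, ← sawtoothSum_one_sub]
    exact main _ (by linarith) (by linarith)

lemma sum_Icc_erase_zero (g : ℤ → ℂ) (N : ℕ) :
    ∑ n ∈ (Finset.Icc (-(N : ℤ)) (N : ℤ)).erase 0, g n
      = ∑ k ∈ Finset.range N, (g (k + 1) + g (-(k + 1))) := by
  induction N with
  | zero => simp
  | succ N ih =>
    have h : (Finset.Icc (-((N + 1 : ℕ) : ℤ)) ((N + 1 : ℕ) : ℤ)).erase 0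
        = insert ((N : ℤ) + 1) (insert (-((N : ℤ) + 1))
          ((Finset.Icc (-(N : ℤ)) (N : ℤ)).erase 0)) := by
      ext x
      simp only [Finset.mem_erase, Finset.mem_Icc, Finset.mem_insert]
      push_cast
      omega
    rw [h, Finset.sum_insert (by simp; omega), Finset.sum_insert (by simp), ih,
      Finset.sum_range_succ]
    ring

lemma sum_fourier_eq_sawtoothSum (N : ℕ) (x : ℝ) :
    ∑ n ∈ (Finset.Icc (-(N : ℤ)) (N : ℤ)).erase 0, 1 / twoPiI n * ee ((n : ℂ) * (x : ℂ))
      = (sawtoothSum N x : ℂ) := by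
  rw [sum_Icc_erase_zero, sawtoothSum, Complex.ofReal_sum]
  refine Finset.sum_congr rfl fun k _ => ?_
  have hk : (k : ℂ) + 1 ≠ 0 := by exact_mod_cast Nat.succ_ne_zero k
  have hpi : (Real.pi : ℂ) ≠ 0 := by exact_mod_cast Real.pi_ne_zero
  have e1 : 2 * (Real.pi : ℂ) * Complex.I * (((k : ℂ) + 1) * x)
      = (2 * Real.pi * (k + 1) * x) * Complex.I := by ring
  have e2 : 2 * (Real.pi : ℂ) * Complex.I * (-((k : ℂ) + 1) * x)
      = -(2 * Real.pi * (k + 1) * x) * Complex.I := by ring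
  simp only [twoPiI, ee]
  push_cast
  rw [Complex.sin, e1, e2]
  generalize Complex.exp (-(2 * Real.pi * (k + 1) * x) * Complex.I) = A
  generalize Complex.exp ((2 * Real.pi * (k + 1) * x) * Complex.I) = B
  field_simp
  linear_combination (B - A) * Complex.I_sq

/-- The exponential sum `∑_{1 ≤ m ≤ M} m ^ r e(nu/m)`. -/
noncomputable def expSum (M : ℤ) (r : ℕ) (n : ℤ) (u : ℝ) : ℂ :=
  ∑ m ∈ Finset.Icc (1 : ℤ) M, (m : ℂ) ^ r * ee ((n : ℂ) * (u : ℂ) / (m : ℂ))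

lemma hasDerivAt_expSum (M : ℤ) (r : ℕ) (n : ℤ) (u : ℝ) :
    HasDerivAt (expSum M (r + 1) n) (twoPiI n * expSum M r n u) u := by
  unfold expSum
  rw [Finset.mul_sum]
  refine HasDerivAt.fun_sum fun m hm => ?_
  have hm0 : (m : ℂ) ≠ 0 := by
    have := (Finset.mem_Icc.1 hm).1
    exact_mod_cast (by omega : m ≠ 0)
  have h := (((((hasDerivAt_id u).ofReal_comp.const_mul (n : ℂ)).div_const (m : ℂ)).const_mul
    (2 * (Real.pi : ℂ) * Complex.I)).cexp).const_mul ((m : ℂ) ^ (r + 1))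
  refine h.congr_deriv ?_
  simp only [ee, twoPiI, id]
  push_cast
  field_simp
  ring

lemma continuous_expSum (M : ℤ) (r : ℕ) (n : ℤ) : Continuous (expSum M r n) := by
  unfold expSum ee
  fun_prop

lemma norm_expSum_le (M : ℤ) (r : ℕ) (n : ℤ) (u : ℝ) :
    ‖expSum M r n u‖ ≤ ∑ m ∈ Finset.Icc (1 : ℤ) M, ‖(m : ℂ) ^ r‖ := by
  refine (norm_sum_le _ _).trans_eq (Finset.sum_congr rfl fun m _ => ?_)
  have h : 2 * (Real.pi : ℂ) * Complex.I * ((n : ℂ) * (u : ℂ) / (m : ℂ))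
      = ((2 * Real.pi * (n * u / m) : ℝ) : ℂ) * Complex.I := by
    push_cast; ring
  rw [norm_mul, ee, h, Complex.norm_exp_ofReal_mul_I, mul_one]

lemma sum_expSum_zero (M : ℤ) (N : ℕ) (u : ℝ) :
    ∑ n ∈ (Finset.Icc (-(N : ℤ)) (N : ℤ)).erase 0, 1 / twoPiI n ^ (0 + 1) * expSum M 0 n u
      = ∑ m ∈ Finset.Icc (1 : ℤ) M, (sawtoothSum N (u / m) : ℂ) := by
  simp only [expSum, Finset.mul_sum]
  rw [Finset.sum_comm]
  refine Finset.sum_congr rfl fun m _ => ?_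
  rw [← sum_fourier_eq_sawtoothSum]
  refine Finset.sum_congr rfl fun n _ => ?_
  rw [zero_add, pow_one, pow_zero, one_mul, Complex.ofReal_div, Complex.ofReal_intCast,
    mul_div_assoc]

lemma symTendsto_expSum_zero (M : ℤ) {x : ℝ} (hx : ∀ n : ℤ, x ≠ n) :
    SymTendsto (fun n => 1 / twoPiI n ^ (0 + 1) * expSum M 0 n x)
      (∑ m ∈ Finset.Icc (1 : ℤ) M, (sawtooth (x / m) : ℂ)) := by
  simp only [SymTendsto, sum_expSum_zero]
  refine tendsto_finsetSum _ fun m hm => ?_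
  refine (Complex.continuous_ofReal.tendsto _).comp (tendsto_sawtoothSum fun n hn => ?_)
  have hm0 : (m : ℝ) ≠ 0 := by
    have := (Finset.mem_Icc.1 hm).1
    exact_mod_cast (by omega : m ≠ 0)
  refine hx (n * m) ?_
  rw [div_eq_iff hm0] at hn
  exact_mod_cast hn

lemma exists_symTendsto_of_norm_le {g : ℤ → ℂ} {C : ℝ} (hg : ∀ n ≠ 0, ‖g n‖ ≤ C / (n : ℝ) ^ 2) :
    ∃ L, SymTendsto g L := by
  have hs : Summable fun k : ℕ => g (k + 1) + g (-(k + 1)) := by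
    have h2 : Summable fun k : ℕ => 2 * C * (1 / ((k + 1 : ℕ) : ℝ) ^ 2) :=
      ((summable_nat_add_iff 1).2 (Real.summable_one_div_nat_pow.2 one_lt_two)).mul_left (2 * C)
    refine Summable.of_norm_bounded h2 fun k => ?_
    refine (norm_add_le _ _).trans ?_
    have h1 := hg (k + 1) (by omega)
    have h3 := hg (-(k + 1)) (by omega)
    push_cast at h1 h3 ⊢
    rw [neg_sq] at h3
    calc _ ≤ C / ((k : ℝ) + 1) ^ 2 + C / ((k : ℝ) + 1) ^ 2 := add_le_add h1 h3
      _ = _ := by ring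
  refine ⟨∑' k : ℕ, (g (k + 1) + g (-(k + 1))), ?_⟩
  simp only [SymTendsto, sum_Icc_erase_zero]
  exact hs.hasSum.tendsto_sum_nat

lemma norm_twoPiI (n : ℤ) : ‖twoPiI n‖ = 2 * Real.pi * |(n : ℝ)| := by
  simp [twoPiI, abs_of_pos Real.pi_pos]

lemma twoPiI_ne_zero {n : ℤ} (hn : n ≠ 0) : twoPiI n ≠ 0 := by
  simp [twoPiI, hn, Real.pi_ne_zero]

lemma exists_symTendsto_expSum_succ (M : ℤ) (r : ℕ) (x : ℝ) :
    ∃ L, SymTendsto (fun n => 1 / twoPiI n ^ (r + 1 + 1) * expSum M (r + 1) n x) L := by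
  refine exists_symTendsto_of_norm_le
    (C := ∑ m ∈ Finset.Icc (1 : ℤ) M, ‖(m : ℂ) ^ (r + 1)‖) fun n hn => ?_
  have h1 : (1 : ℝ) ≤ |(n : ℝ)| := by exact_mod_cast Int.one_le_abs hn
  have h2 : |(n : ℝ)| ≤ ‖twoPiI n‖ := by
    rw [norm_twoPiI]
    nlinarith [Real.pi_gt_three]
  have h3 : (n : ℝ) ^ 2 ≤ ‖twoPiI n‖ ^ (r + 1 + 1) := by
    rw [← sq_abs]
    exact (pow_le_pow_left₀ (abs_nonneg _) h2 2).trans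
      (pow_le_pow_right₀ (h1.trans h2) (by omega))
  have h4 : (0 : ℝ) < (n : ℝ) ^ 2 := by positivity
  rw [norm_mul, norm_div, norm_one, norm_pow, one_div_mul_eq_div]
  exact div_le_div₀ (Finset.sum_nonneg fun _ _ => norm_nonneg _) (norm_expSum_le _ _ _ _) h4 h3

lemma intervalIntegrable_of_continuousOn_Icc {g : ℝ → ℂ} {a b : ℝ} (hab : a ≤ b)
    (hg : ContinuousOn g (Set.Icc a b)) : IntervalIntegrable g volume a b :=
  ContinuousOn.intervalIntegrable (by rwa [Set.uIcc_of_le hab])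

lemma ae_forall_ne_intCast : ∀ᵐ u : ℝ, ∀ n : ℤ, u ≠ n := by
  rw [ae_all_iff]
  exact fun n => Measure.ae_ne volume (n : ℝ)

lemma symTendsto_integral_expSum_zero (M : ℤ) {a b : ℝ} (hab : a ≤ b) {g : ℝ → ℂ}
    (hg : ContinuousOn g (Set.Icc a b)) :
    SymTendsto (fun n => 1 / twoPiI n ^ (0 + 1) * ∫ u in a..b, g u * expSum M 0 n u)
      (∫ u in a..b, g u * ∑ m ∈ Finset.Icc (1 : ℤ) M, (sawtooth (u / m) : ℂ)) := by
  have hsum : ∀ N : ℕ, ∑ n ∈ (Finset.Icc (-(N : ℤ)) (N : ℤ)).erase 0,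
      1 / twoPiI n ^ (0 + 1) * ∫ u in a..b, g u * expSum M 0 n u
      = ∫ u in a..b, g u * ∑ m ∈ Finset.Icc (1 : ℤ) M, (sawtoothSum N (u / m) : ℂ) := by
    intro N
    simp only [← sum_expSum_zero, ← intervalIntegral.integral_const_mul]
    rw [← intervalIntegral.integral_finsetSum]
    · refine intervalIntegral.integral_congr fun u _ => ?_
      simp only [Finset.mul_sum]
      exact Finset.sum_congr rfl fun n _ => by ring
    · intro n _
      exact (intervalIntegrable_of_continuousOn_Icc hab
        (hg.mul (continuous_expSum M 0 n).continuousOn)).const_mul _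
  simp only [SymTendsto, hsum]
  have hI : Set.uIoc a b ⊆ Set.Icc a b := by
    rw [Set.uIoc_of_le hab]; exact Set.Ioc_subset_Icc_self
  refine intervalIntegral.tendsto_integral_filter_of_dominated_convergence
    (fun u => ‖g u‖ * ∑ m ∈ Finset.Icc (1 : ℤ) M, 2) ?_ ?_ ?_ ?_
  · refine Eventually.of_forall fun N => ?_
    refine ((hg.mono hI).mul ?_).aestronglyMeasurable measurableSet_uIoc
    unfold sawtoothSum
    exact Continuous.continuousOn (by fun_prop)
  · refine Eventually.of_forall fun N => Eventually.of_forall fun u _ => ?_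
    rw [norm_mul]
    refine mul_le_mul_of_nonneg_left ?_ (norm_nonneg _)
    refine (norm_sum_le _ _).trans (Finset.sum_le_sum fun m _ => ?_)
    rw [Complex.norm_real]
    exact abs_sawtoothSum_le N _
  · exact ((intervalIntegrable_of_continuousOn_Icc hab hg).norm).mul_const _
  · filter_upwards [ae_forall_ne_intCast] with u hu _
    refine Tendsto.const_mul _ ?_
    have := symTendsto_expSum_zero M hu
    simpa only [SymTendsto, sum_expSum_zero] using this

lemma integral_deriv_mul_expSum (M : ℤ) (r : ℕ) {n : ℤ} (hn : n ≠ 0) {a b : ℝ} (hab : a ≤ b)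
    {g g' : ℝ → ℂ} (hg : ContinuousOn g (Set.Icc a b)) (hg' : ContinuousOn g' (Set.Icc a b))
    (hd : ∀ u ∈ Set.Ioo a b, HasDerivAt g (g' u) u) :
    1 / twoPiI n ^ (r + 1 + 1) * ∫ u in a..b, g' u * expSum M (r + 1) n u
      = g b * (1 / twoPiI n ^ (r + 1 + 1) * expSum M (r + 1) n b)
        - g a * (1 / twoPiI n ^ (r + 1 + 1) * expSum M (r + 1) n a)
        - 1 / twoPiI n ^ (r + 1) * ∫ u in a..b, g u * expSum M r n u := by
  have hw : Continuous (fun u => twoPiI n * expSum M r n u) :=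
    continuous_const.mul (continuous_expSum M r n)
  have h := intervalIntegral.integral_mul_deriv_eq_deriv_mul_of_hasDerivAt (a := a) (b := b)
    (u := g) (v := expSum M (r + 1) n) (u' := g') (v' := fun u => twoPiI n * expSum M r n u)
    (by rwa [Set.uIcc_of_le hab]) (continuous_expSum M (r + 1) n).continuousOn
    (by rwa [min_eq_left hab, max_eq_right hab]) (fun u _ => hasDerivAt_expSum M r n u)
    (intervalIntegrable_of_continuousOn_Icc hab hg') (hw.intervalIntegrable _ _)
  have h2 : ∫ u in a..b, g u * (twoPiI n * expSum M r n u)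
      = twoPiI n * ∫ u in a..b, g u * expSum M r n u := by
    rw [← intervalIntegral.integral_const_mul]
    exact intervalIntegral.integral_congr fun u _ => by ring
  rw [h2] at h
  have h3 := twoPiI_ne_zero hn
  have h4 : 1 / twoPiI n ^ (r + 1 + 1) * twoPiI n = 1 / twoPiI n ^ (r + 1) := by
    field_simp
    ring
  linear_combination (1 / twoPiI n ^ (r + 1 + 1)) * h
    - (∫ u in a..b, g u * expSum M r n u) * h4

lemma abs_sawtooth_le (x : ℝ) : |sawtooth x| ≤ 1 := by
  have h0 := Int.fract_nonneg x
  have h1 := Int.fract_lt_one x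
  rw [sawtooth, abs_le]
  constructor <;> linarith

lemma measurable_sawtooth : Measurable sawtooth :=
  measurable_fract.const_sub (1 / 2)

lemma intervalIntegrable_mul_sawtooth {g : ℝ → ℂ} {a b : ℝ}
    (hg : IntervalIntegrable g volume a b) (c : ℝ) :
    IntervalIntegrable (fun u => g u * (sawtooth (u / c) : ℂ)) volume a b := by
  have hm : Measurable fun u : ℝ => (sawtooth (u / c) : ℂ) :=
    Complex.measurable_ofReal.comp (measurable_sawtooth.comp (measurable_id.div_const c))
  have hb : ∀ u : ℝ, ‖(sawtooth (u / c) : ℂ)‖ ≤ 1 := fun u => by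
    rw [Complex.norm_real]; exact abs_sawtooth_le _
  exact ⟨hg.1.mul_bdd hm.aestronglyMeasurable (Eventually.of_forall hb),
    hg.2.mul_bdd hm.aestronglyMeasurable (Eventually.of_forall hb)⟩

lemma card_filter_dvd_Ioc_floor {m : ℤ} (hm : 0 < m) {a u : ℝ} (hau : a ≤ u) :
    (((Finset.Ioc ⌊a⌋ ⌊u⌋).filter (m ∣ ·)).card : ℤ) = ⌊u / m⌋ - ⌊a / m⌋ := by
  rw [Int.Ioc_filter_dvd_card _ _ hm, Int.floor_div_cast_of_nonneg hm.le,
    Int.floor_div_cast_of_nonneg hm.le, Int.floor_div_cast_of_nonneg hm.le,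
    Int.floor_div_cast_of_nonneg hm.le, Int.floor_intCast, Int.floor_intCast, max_eq_left]
  exact sub_nonneg.2 (Int.ediv_le_ediv hm (Int.floor_le_floor hau))

section PartialSummation

variable {a b : ℝ} {f f' : ℝ → ℂ}

lemma integral_deriv_eq_sub_of_mem_Icc (hf : ContinuousOn f (Set.Icc a b))
    (hf' : ContinuousOn f' (Set.Icc a b)) (hd : ∀ u ∈ Set.Ioo a b, HasDerivAt f (f' u) u)
    {x : ℝ} (hx : x ∈ Set.Icc a b) : ∫ u in x..b, f' u = f b - f x :=
  intervalIntegral.integral_eq_sub_of_hasDerivAt_of_le hx.2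
    (hf.mono (Set.Icc_subset_Icc_left hx.1))
    (fun u hu => hd u ⟨hx.1.trans_lt hu.1, hu.2⟩)
    (intervalIntegrable_of_continuousOn_Icc hx.2 (hf'.mono (Set.Icc_subset_Icc_left hx.1)))

lemma sum_eq_sub_integral_card (hab : a ≤ b) (hf : ContinuousOn f (Set.Icc a b))
    (hf' : ContinuousOn f' (Set.Icc a b)) (hd : ∀ u ∈ Set.Ioo a b, HasDerivAt f (f' u) u)
    (s : Finset ℤ) (hs : ∀ n ∈ s, (n : ℝ) ∈ Set.Ioc a b) :
    ∑ n ∈ s, f n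
      = s.card * f b - ∫ u in a..b, f' u * ((s.filter fun n : ℤ => (n : ℝ) ≤ u).card : ℂ) := by
  have hfint := intervalIntegrable_of_continuousOn_Icc hab hf'
  have hind : ∀ n : ℤ, (fun u => f' u * (if (n : ℝ) ≤ u then (1 : ℂ) else 0))
      = (Set.Ici (n : ℝ)).indicator f' := by
    intro n
    ext u
    by_cases h : (n : ℝ) ≤ u <;> simp [h]
  have hii : ∀ n : ℤ, IntervalIntegrable
      (fun u => f' u * (if (n : ℝ) ≤ u then (1 : ℂ) else 0)) volume a b := by
    intro n
    rw [hind]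
    exact ⟨hfint.1.indicator measurableSet_Ici, hfint.2.indicator measurableSet_Ici⟩
  have hterm : ∀ n ∈ s, f n = f b - ∫ u in a..b, f' u * (if (n : ℝ) ≤ u then (1 : ℂ) else 0) := by
    intro n hn
    have hn' := hs n hn
    have hI : (n : ℝ) ∈ Set.Icc a b := ⟨hn'.1.le, hn'.2⟩
    have h1 : ∫ u in a..b, f' u * (if (n : ℝ) ≤ u then (1 : ℂ) else 0) = ∫ u in (n : ℝ)..b, f' u := by
      rw [← intervalIntegral.integral_add_adjacent_intervals
        ((hii n).mono_set (Set.uIcc_subset_uIcc_left (Set.mem_uIcc_of_le hI.1 hI.2)))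
        ((hii n).mono_set (Set.uIcc_subset_uIcc_right (Set.mem_uIcc_of_le hI.1 hI.2)))]
      have e1 : ∫ u in a..(n : ℝ), f' u * (if (n : ℝ) ≤ u then (1 : ℂ) else 0) = 0 := by
        rw [intervalIntegral.integral_of_le hI.1, integral_Ioc_eq_integral_Ioo]
        refine setIntegral_eq_zero_of_forall_eq_zero fun u hu => ?_
        rw [if_neg (not_le.2 hu.2), mul_zero]
      have e2 : ∫ u in (n : ℝ)..b, f' u * (if (n : ℝ) ≤ u then (1 : ℂ) else 0)
          = ∫ u in (n : ℝ)..b, f' u := by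
        refine intervalIntegral.integral_congr fun u hu => ?_
        rw [Set.uIcc_of_le hI.2] at hu
        simp only [if_pos hu.1, mul_one]
      rw [e1, e2, zero_add]
    rw [h1, integral_deriv_eq_sub_of_mem_Icc hf hf' hd hI]
    ring
  rw [Finset.sum_congr rfl hterm, Finset.sum_sub_distrib, Finset.sum_const, nsmul_eq_mul,
    ← intervalIntegral.integral_finsetSum fun n _ => hii n]
  congr 1
  refine intervalIntegral.integral_congr fun u _ => ?_
  simp only [← Finset.mul_sum, Finset.sum_boole]

lemma sum_multiples_eq (hab : a ≤ b) (hf : ContinuousOn f (Set.Icc a b))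
    (hf' : ContinuousOn f' (Set.Icc a b)) (hd : ∀ u ∈ Set.Ioo a b, HasDerivAt f (f' u) u)
    {m : ℤ} (hm : 0 < m) :
    ∑ n ∈ (Finset.Ioc ⌊a⌋ ⌊b⌋).filter (m ∣ ·), f n
      = 1 / (m : ℂ) * (∫ u in a..b, f u)
        + (f b * (sawtooth (b / m) : ℂ) - f a * (sawtooth (a / m) : ℂ))
        - ∫ u in a..b, f' u * (sawtooth (u / m) : ℂ) := by
  have hfint := intervalIntegrable_of_continuousOn_Icc hab hf'
  have hfloor : ∀ x : ℝ, (⌊x⌋ : ℂ) = (x : ℂ) - 1 / 2 + (sawtooth x : ℂ) := by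
    intro x
    have : (⌊x⌋ : ℝ) = x - 1 / 2 + sawtooth x := by
      rw [sawtooth, Int.fract]; ring
    rw [← Complex.ofReal_intCast, this]
    push_cast; ring
  have hcard : ∀ u, a ≤ u → (((Finset.Ioc ⌊a⌋ ⌊u⌋).filter (m ∣ ·)).card : ℂ)
      = (u / m : ℂ) + (sawtooth (u / m) : ℂ) - ((a / m : ℂ) + (sawtooth (a / m) : ℂ)) := by
    intro u hu
    have := congrArg (fun z : ℤ => (z : ℂ)) (card_filter_dvd_Ioc_floor hm hu)
    simp only [Int.cast_natCast, Int.cast_sub, hfloor] at this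
    rw [this]
    push_cast
    ring
  rw [sum_eq_sub_integral_card hab hf hf' hd _ fun n hn => ?_]
  · have hI : ∫ u in a..b, f' u * ((((Finset.Ioc ⌊a⌋ ⌊b⌋).filter (m ∣ ·)).filter
          fun n : ℤ => (n : ℝ) ≤ u).card : ℂ)
        = ∫ u in a..b, (1 / (m : ℂ) * (f' u * (u : ℂ)) + f' u * (sawtooth (u / m) : ℂ)
          - ((a / m : ℂ) + (sawtooth (a / m) : ℂ)) * f' u) := by
      refine intervalIntegral.integral_congr fun u hu => ?_
      rw [Set.uIcc_of_le hab] at hu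
      have hset : ((Finset.Ioc ⌊a⌋ ⌊b⌋).filter (m ∣ ·)).filter (fun n : ℤ => (n : ℝ) ≤ u)
          = (Finset.Ioc ⌊a⌋ ⌊u⌋).filter (m ∣ ·) := by
        ext n
        have hub := Int.floor_le_floor hu.2
        simp only [Finset.mem_filter, Finset.mem_Ioc, ← Int.le_floor]
        constructor
        · rintro ⟨⟨⟨h1, _⟩, h2⟩, h3⟩
          exact ⟨⟨h1, h3⟩, h2⟩
        · rintro ⟨⟨h1, h3⟩, h2⟩
          exact ⟨⟨⟨h1, h3.trans hub⟩, h2⟩, h3⟩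
      simp only [hset, hcard u hu.1]
      ring
    have hu : IntervalIntegrable (fun u : ℝ => f' u * (u : ℂ)) volume a b :=
      intervalIntegrable_of_continuousOn_Icc hab
        (hf'.mul Complex.continuous_ofReal.continuousOn)
    have hparts : ∫ u in a..b, f' u * (u : ℂ) = f b * b - f a * a - ∫ u in a..b, f u := by
      have h := intervalIntegral.integral_mul_deriv_eq_deriv_mul_of_hasDerivAt (a := a) (b := b)
        (u := f) (u' := f') (v := fun u : ℝ => (u : ℂ)) (v' := fun _ => 1)
        (by rwa [Set.uIcc_of_le hab]) Complex.continuous_ofReal.continuousOn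
        (by rwa [min_eq_left hab, max_eq_right hab])
        (fun u _ => (hasDerivAt_id u).ofReal_comp) hfint intervalIntegrable_const
      simp only [mul_one] at h
      linear_combination h
    rw [hI, intervalIntegral.integral_sub
        ((hu.const_mul _).add (intervalIntegrable_mul_sawtooth hfint m)) (hfint.const_mul _),
      intervalIntegral.integral_add (hu.const_mul _) (intervalIntegrable_mul_sawtooth hfint m),
      intervalIntegral.integral_const_mul, intervalIntegral.integral_const_mul, hparts,
      integral_deriv_eq_sub_of_mem_Icc hf hf' hd (Set.left_mem_Icc.2 hab), hcard b hab]
    ring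
  · have h := Finset.mem_Ioc.1 (Finset.mem_filter.1 hn).1
    exact ⟨Int.floor_lt.1 h.1, Int.le_floor.1 h.2⟩

end PartialSummation

lemma card_divisors_toNat_eq {n M : ℤ} (hn : 0 < n) (hnM : n ≤ M) :
    n.toNat.divisors.card = ((Finset.Icc 1 M).filter (· ∣ n)).card := by
  refine Finset.card_bij (fun d _ => (d : ℤ)) ?_ ?_ ?_
  · intro d hd
    have hdvd := Nat.dvd_of_mem_divisors hd
    have hpos := Nat.pos_of_mem_divisors hd
    have hdvd' : (d : ℤ) ∣ n := by
      rw [← Int.toNat_of_nonneg hn.le]; exact_mod_cast hdvd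
    have := Int.le_of_dvd hn hdvd'
    simp only [Finset.mem_filter, Finset.mem_Icc]
    exact ⟨⟨by omega, by omega⟩, hdvd'⟩
  · intro d _ e _ h
    exact_mod_cast h
  · intro m hm
    simp only [Finset.mem_filter, Finset.mem_Icc] at hm
    refine ⟨m.toNat, ?_, by omega⟩
    rw [Nat.mem_divisors]
    refine ⟨?_, by omega⟩
    zify
    rw [Int.toNat_of_nonneg (by omega), Int.toNat_of_nonneg hn.le]
    exact hm.2

lemma sum_divisors_mul_eq {a b : ℝ} (ha0 : 0 ≤ a) (f : ℝ → ℂ) :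
    ∑ n ∈ Finset.Ioc ⌊a⌋ ⌊b⌋, (n.toNat.divisors.card : ℂ) * f (n : ℝ)
      = ∑ m ∈ Finset.Icc (1 : ℤ) ⌊b⌋, ∑ n ∈ (Finset.Ioc ⌊a⌋ ⌊b⌋).filter (m ∣ ·), f n := by
  simp only [Finset.sum_filter]
  rw [Finset.sum_comm]
  refine Finset.sum_congr rfl fun n hn => ?_
  have h := Finset.mem_Ioc.1 hn
  rw [card_divisors_toNat_eq ((Int.floor_nonneg.2 ha0).trans_lt h.1) h.2, ← Finset.sum_filter,
    Finset.sum_const, nsmul_eq_mul]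

lemma euler_maclaurin_divisor_of_hasDerivAt {a b : ℝ} (ha0 : 0 ≤ a) (hab : a < b)
    (Tb Ta : ℕ → ℂ)
    (hTb : ∀ r, SymTendsto (fun n => 1 / twoPiI n ^ (r + 1) * expSum ⌊b⌋ r n b) (Tb r))
    (hTa : ∀ r, SymTendsto (fun n => 1 / twoPiI n ^ (r + 1) * expSum ⌊b⌋ r n a) (Ta r))
    (hTb0 : Tb 0 = ∑ m ∈ Finset.Icc (1 : ℤ) ⌊b⌋, (sawtooth (b / m) : ℂ))
    (hTa0 : Ta 0 = ∑ m ∈ Finset.Icc (1 : ℤ) ⌊b⌋, (sawtooth (a / m) : ℂ))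
    (h : ℕ → ℝ → ℂ) (R : ℕ) (hc : ∀ r ≤ R + 1, ContinuousOn (h r) (Set.Icc a b))
    (hd : ∀ r ≤ R, ∀ u ∈ Set.Ioo a b, HasDerivAt (h r) (h (r + 1) u) u) :
    ∃ J, SymTendsto
        (fun n => 1 / twoPiI n ^ (R + 1) * ∫ u in a..b, h (R + 1) u * expSum ⌊b⌋ R n u) J ∧
      ∑ n ∈ Finset.Ioc ⌊a⌋ ⌊b⌋, (n.toNat.divisors.card : ℂ) * h 0 (n : ℝ)
        = (∑ m ∈ Finset.Icc (1 : ℤ) ⌊b⌋, 1 / (m : ℂ)) * (∫ u in a..b, h 0 u)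
          + (∑ r ∈ Finset.range (R + 1), (-1 : ℂ) ^ r * (h r b * Tb r - h r a * Ta r))
          + (-1 : ℂ) ^ (R + 1) * J := by
  induction R with
  | zero =>
    refine ⟨_, symTendsto_integral_expSum_zero ⌊b⌋ hab.le (hc 1 le_rfl), ?_⟩
    have hfint := intervalIntegrable_of_continuousOn_Icc hab.le (hc 1 le_rfl)
    rw [sum_divisors_mul_eq ha0, Finset.sum_congr rfl fun (m : ℤ) hm =>
      sum_multiples_eq hab.le (hc 0 (by omega)) (hc 1 le_rfl) (hd 0 le_rfl)
        (by have := (Finset.mem_Icc.1 hm).1; omega : 0 < m)]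
    simp only [Finset.mul_sum (Finset.Icc 1 ⌊b⌋) _ (h (0 + 1) _)]
    rw [intervalIntegral.integral_finsetSum fun (m : ℤ) _ =>
      intervalIntegrable_mul_sawtooth hfint m]
    simp only [Finset.sum_sub_distrib, Finset.sum_add_distrib, ← Finset.sum_mul,
      ← Finset.mul_sum, ← hTa0, ← hTb0]
    simp
    ring
  | succ R ih =>
    obtain ⟨J, hJ, hsum⟩ := ih (fun r hr => hc r (by omega)) (fun r hr => hd r (by omega))
    refine ⟨h (R + 1) b * Tb (R + 1) - h (R + 1) a * Ta (R + 1) - J, ?_, ?_⟩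
    · have := (((hTb (R + 1)).const_mul (h (R + 1) b)).sub
        ((hTa (R + 1)).const_mul (h (R + 1) a))).sub hJ
      refine this.congr fun N => ?_
      simp only [Finset.mul_sum, ← Finset.sum_sub_distrib]
      refine Finset.sum_congr rfl fun n hn => ?_
      exact (integral_deriv_mul_expSum ⌊b⌋ R (Finset.ne_of_mem_erase hn) hab.le
        (hc (R + 1) (by omega)) (hc (R + 1 + 1) le_rfl) (hd (R + 1) le_rfl)).symm
    · rw [hsum, Finset.sum_range_succ _ (R + 1)]
      ring

lemma hasDerivAt_iteratedDerivWithin_Icc {a b : ℝ} (hab : a < b) {f : ℝ → ℂ} {R r : ℕ}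
    (hf : ContDiffOn ℝ (R + 1) f (Set.Icc a b)) (hr : r ≤ R) {u : ℝ} (hu : u ∈ Set.Ioo a b) :
    HasDerivAt (iteratedDerivWithin r f (Set.Icc a b))
      (iteratedDerivWithin (r + 1) f (Set.Icc a b) u) u := by
  have hd := hf.differentiableOn_iteratedDerivWithin (m := r)
    (by exact_mod_cast Nat.lt_succ_of_le hr) (uniqueDiffOn_Icc hab) u (Set.Ioo_subset_Icc_self hu)
  rw [iteratedDerivWithin_succ]
  exact hd.hasDerivWithinAt.hasDerivAt (Icc_mem_nhds hu.1 hu.2)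

lemma exists_symTendsto_expSum (M : ℤ) {x : ℝ} (hx : ∀ n : ℤ, x ≠ n) :
    ∃ T : ℕ → ℂ, (∀ r, SymTendsto (fun n => 1 / twoPiI n ^ (r + 1) * expSum M r n x) (T r)) ∧
      T 0 = ∑ m ∈ Finset.Icc (1 : ℤ) M, (sawtooth (x / m) : ℂ) := by
  choose L hL using fun r => exists_symTendsto_expSum_succ M r x
  refine ⟨fun r => Nat.casesOn r (∑ m ∈ Finset.Icc (1 : ℤ) M, (sawtooth (x / m) : ℂ)) L, ?_, rfl⟩
  rintro (_ | r)
  · exact symTendsto_expSum_zero M hx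
  · exact hL r

/-- Euler–Maclaurin analogue for the divisor function (Theorem 1(II)). -/
theorem euler_maclaurin_divisor
    (R : ℕ) (a b : ℝ) (ha0 : 0 ≤ a) (hab : a < b)
    (ha : ∀ n : ℤ, a ≠ (n : ℝ)) (hb : ∀ n : ℤ, b ≠ (n : ℝ))
    (f : ℝ → ℂ) (hf : ContDiffOn ℝ (R + 1) f (Set.Icc a b)) :
    ∃ Tb Ta : ℕ → ℂ, ∃ J : ℂ,
      (∀ r, r ≤ R → SymTendsto
        (fun n => 1 / (twoPiI n) ^ (r + 1) *
          ∑ m ∈ Finset.Icc (1 : ℤ) ⌊b⌋, (m : ℂ) ^ r * ee ((n : ℂ) * (b : ℂ) / (m : ℂ)))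
        (Tb r)) ∧
      (∀ r, r ≤ R → SymTendsto
        (fun n => 1 / (twoPiI n) ^ (r + 1) *
          ∑ m ∈ Finset.Icc (1 : ℤ) ⌊b⌋, (m : ℂ) ^ r * ee ((n : ℂ) * (a : ℂ) / (m : ℂ)))
        (Ta r)) ∧
      SymTendsto
        (fun n => 1 / (twoPiI n) ^ (R + 1) *
          ∫ u in a..b, iteratedDerivWithin (R + 1) f (Set.Icc a b) u *
            ∑ m ∈ Finset.Icc (1 : ℤ) ⌊b⌋, (m : ℂ) ^ R * ee ((n : ℂ) * (u : ℂ) / (m : ℂ)))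
        J ∧
      ∑ n ∈ Finset.Ioc ⌊a⌋ ⌊b⌋, (n.toNat.divisors.card : ℂ) * f (n : ℝ)
        = (∑ m ∈ Finset.Icc (1 : ℤ) ⌊b⌋, 1 / (m : ℂ)) * (∫ u in a..b, f u)
          + (∑ r ∈ Finset.range (R + 1), (-1 : ℂ) ^ r *
              (iteratedDerivWithin r f (Set.Icc a b) b * Tb r
                - iteratedDerivWithin r f (Set.Icc a b) a * Ta r))
          + (-1 : ℂ) ^ (R + 1) * J := by
  obtain ⟨Tb, hTb, hTb0⟩ := exists_symTendsto_expSum ⌊b⌋ hb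
  obtain ⟨Ta, hTa, hTa0⟩ := exists_symTendsto_expSum ⌊b⌋ ha
  obtain ⟨J, hJ, hsum⟩ := euler_maclaurin_divisor_of_hasDerivAt ha0 hab Tb Ta hTb hTa hTb0 hTa0
    (fun r => iteratedDerivWithin r f (Set.Icc a b)) R
    (fun r hr => hf.continuousOn_iteratedDerivWithin (by exact_mod_cast hr) (uniqueDiffOn_Icc hab))
    (fun r hr u hu => hasDerivAt_iteratedDerivWithin_Icc hab hf hr hu)
  refine ⟨Tb, Ta, J, fun r _ => hTb r, fun r _ => hTa r, hJ, ?_⟩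
  simpa only [iteratedDerivWithin_zero] using hsum
end

section
/- Euler–Maclaurin analogue for the divisor function with a periodic weight (Theorem 1(III)): Let k ≥ 1 be an integer, χ : ℤ → ℂ with χ(n + k) = χ(n) for all n, R ≥ 0 an integer, a, b real numbers with 0 ≤ a < b and a, b ∉ ℤ, and f : ℝ → ℂ with continuous derivatives up to order R + 1 on [a,b]. Then all the symmetric series below converge and Σ_{a < n ≤ b} χ(n) d(n) f(n) = (1/k) Σ_{r₁=1}^{k} Σ_{r₂=1}^{k} χ(r₁ r₂) ( Σ_{1 ≤ m ≤ b, m ≡ r₁ (mod k)} 1/m ) ∫_a^b f(u) du + Σ_{r=0}^{R} (−1)^r k^r Σ_{r₁=1}^{k} Σ_{r₂=1}^{k} χ(r₁ r₂) · { f^{(r)}(b) · Σ′_n ( e^{−2πinr₂/k}/(2πin)^{r+1} ) Σ_{1 ≤ m ≤ b, m ≡ r₁ (mod k)} m^r e^{2πinb/(mk)} − f^{(r)}(a) · Σ′_n ( e^{−2πinr₂/k}/(2πin)^{r+1} ) Σ_{1 ≤ m ≤ b, m ≡ r₁ (mod k)} m^r e^{2πina/(mk)} } + (−1)^{R+1}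 k^R Σ_{r₁=1}^{k} Σ_{r₂=1}^{k} χ(r₁ r₂) Σ′_n ( e^{−2πinr₂/k}/(2πin)^{R+1} ) ∫_a^b f^{(R+1)}(u) ( Σ_{1 ≤ m ≤ b, m ≡ r₁ (mod k)} m^R e^{2πinu/(mk)} ) du. -/
open MeasureTheory intervalIntegral Filter

/-! ### The exponential `ee` -/

lemma ee_add (x y : ℂ) : ee (x + y) = ee x * ee y := by
  simp only [ee, ← Complex.exp_add]; ring_nf

lemma ee_zero : ee 0 = 1 := by simp [ee]

lemma ee_natCast_mul (n : ℕ) (x : ℂ) : ee (n * x) = ee x ^ n := by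
  simp only [ee, ← Complex.exp_nat_mul]; ring_nf

lemma norm_ee_ofReal (x : ℝ) : ‖ee x‖ = 1 := by
  rw [ee, show 2 * (Real.pi : ℂ) * Complex.I * x = ((2 * Real.pi * x : ℝ) : ℂ) * Complex.I by
    push_cast; ring]
  exact Complex.norm_exp_ofReal_mul_I _

lemma ee_ofReal_eq_one_iff (x : ℝ) : ee x = 1 ↔ ∃ n : ℤ, x = n := by
  rw [ee, Complex.exp_eq_one_iff]
  refine exists_congr fun n => ?_
  have h : (2 * (Real.pi : ℂ) * Complex.I) ≠ 0 := Complex.two_pi_I_ne_zero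
  rw [mul_comm (n : ℂ), mul_right_inj' h]
  norm_cast

lemma continuous_ee : Continuous ee := by unfold ee; fun_prop

lemma ee_intCast (n : ℤ) : ee n = 1 := by
  have := (ee_ofReal_eq_one_iff (n : ℝ)).2 ⟨n, rfl⟩
  simpa using this

/-! ### Symmetric sums -/

lemma sum_Icc_symm_erase_zero (g : ℤ → ℂ) (N : ℕ) :
    ∑ n ∈ (Finset.Icc (-(N : ℤ)) (N : ℤ)).erase 0, g n
      = ∑ i ∈ Finset.range N, (g (i + 1) + g (-(i + 1))) := by
  induction N with
  | zero => simp
  | succ N ih =>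
    have h : (Finset.Icc (-((N + 1 : ℕ) : ℤ)) ((N + 1 : ℕ) : ℤ)).erase 0
        = insert ((N : ℤ) + 1) (insert (-((N : ℤ) + 1))
          ((Finset.Icc (-(N : ℤ)) (N : ℤ)).erase 0)) := by
      ext x
      simp only [Finset.mem_erase, Finset.mem_Icc, Finset.mem_insert]
      push_cast
      omega
    rw [h, Finset.sum_insert, Finset.sum_insert, ih, Finset.sum_range_succ]
    · ring
    · simp
    · simp only [Finset.mem_erase, Finset.mem_Icc, Finset.mem_insert]
      omega

lemma sum_Icc_symm_eq (g : ℤ → ℂ) (N : ℕ) :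
    ∑ n ∈ Finset.Icc (-(N : ℤ)) (N : ℤ), g n
      = g 0 + ∑ n ∈ (Finset.Icc (-(N : ℤ)) (N : ℤ)).erase 0, g n :=
  (Finset.add_sum_erase _ _ (by simp)).symm

lemma SymTendsto.const_mul {g : ℤ → ℂ} {L : ℂ} (c : ℂ) (h : SymTendsto g L) :
    SymTendsto (fun n => c * g n) (c * L) := by
  unfold SymTendsto at *
  simpa only [Finset.mul_sum] using Tendsto.const_mul c h

lemma SymTendsto.sub {g g' : ℤ → ℂ} {L L' : ℂ} (h : SymTendsto g L) (h' : SymTendsto g' L') :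
    SymTendsto (fun n => g n - g' n) (L - L') := by
  unfold SymTendsto at *
  simpa only [Finset.sum_sub_distrib] using Tendsto.sub h h'

lemma SymTendsto.sum {ι : Type*} (s : Finset ι) {g : ι → ℤ → ℂ} {L : ι → ℂ}
    (h : ∀ i ∈ s, SymTendsto (g i) (L i)) :
    SymTendsto (fun n => ∑ i ∈ s, g i n) (∑ i ∈ s, L i) := by
  unfold SymTendsto at *
  simp_rw [Finset.sum_comm (t := s)]
  exact tendsto_finsetSum _ h

lemma SymTendsto.congr {g g' : ℤ → ℂ} {L : ℂ} (h : SymTendsto g L)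
    (hg : ∀ n ≠ 0, g n = g' n) : SymTendsto g' L := by
  unfold SymTendsto at *
  refine h.congr fun N => Finset.sum_congr rfl fun n hn => hg n (Finset.ne_of_mem_erase hn)

/-- Dirichlet's test for the one-sided series `∑ z ^ (i + 1) / (i + 1) ^ (r + 1)`, `|z| = 1`. -/
lemma exists_tendsto_sum_pow_div_pow {z : ℂ} (hz : ‖z‖ = 1) (hz1 : z ≠ 1) (r : ℕ) :
    ∃ L, Tendsto (fun N : ℕ => ∑ i ∈ Finset.range N, z ^ (i + 1) / ((i : ℂ) + 1) ^ (r + 1))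
      atTop (nhds L) := by
  have hanti : Antitone fun i : ℕ => (1 / ((i : ℝ) + 1)) ^ (r + 1) := by
    intro i j hij
    dsimp only
    gcongr
  have h0 : Tendsto (fun i : ℕ => (1 / ((i : ℝ) + 1)) ^ (r + 1)) atTop (nhds 0) := by
    simpa using (tendsto_one_div_add_atTop_nhds_zero_nat (𝕜 := ℝ)).pow (r + 1)
  have hb : ∀ n : ℕ, ‖∑ i ∈ Finset.range n, z ^ (i + 1)‖ ≤ 2 / ‖z - 1‖ := by
    intro n
    have : ∑ i ∈ Finset.range n, z ^ (i + 1) = z * ((z ^ n - 1) / (z - 1)) := by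
      rw [← geom_sum_eq hz1, Finset.mul_sum]
      exact Finset.sum_congr rfl fun i _ => by ring
    rw [this, norm_mul, hz, one_mul, norm_div]
    gcongr
    calc ‖z ^ n - 1‖ ≤ ‖z ^ n‖ + ‖(1 : ℂ)‖ := norm_sub_le _ _
      _ = 2 := by rw [norm_pow, hz]; norm_num
  obtain ⟨L, hL⟩ := cauchySeq_tendsto_of_complete
    (hanti.cauchySeq_series_mul_of_tendsto_zero_of_bounded h0 hb)
  refine ⟨L, hL.congr fun N => Finset.sum_congr rfl fun i _ => ?_⟩
  rw [Complex.real_smul]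
  push_cast
  rw [div_pow, one_pow]
  ring

lemma exists_symTendsto_ee_div_pow {x : ℝ} (hx : ∀ n : ℤ, x ≠ n) (r : ℕ) :
    ∃ L, SymTendsto (fun n => ee (n * x) / twoPiI n ^ (r + 1)) L := by
  obtain ⟨L₁, h₁⟩ := exists_tendsto_sum_pow_div_pow (norm_ee_ofReal x)
    (fun h => by obtain ⟨n, hn⟩ := (ee_ofReal_eq_one_iff x).1 h; exact hx n hn) r
  obtain ⟨L₂, h₂⟩ := exists_tendsto_sum_pow_div_pow (norm_ee_ofReal (-x))
    (fun h => by
      obtain ⟨n, hn⟩ := (ee_ofReal_eq_one_iff (-x)).1 h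
      exact hx (-n) (by push_cast; linarith)) r
  refine ⟨1 / (2 * (Real.pi : ℂ) * Complex.I) ^ (r + 1) * L₁
    + 1 / (-(2 * (Real.pi : ℂ) * Complex.I)) ^ (r + 1) * L₂, ?_⟩
  unfold SymTendsto
  simp_rw [sum_Icc_symm_erase_zero, Finset.sum_add_distrib]
  refine ((h₁.const_mul _).add (h₂.const_mul _)).congr fun N => ?_
  rw [Finset.mul_sum, Finset.mul_sum]
  congr 1
  · refine Finset.sum_congr rfl fun i _ => ?_
    rw [← ee_natCast_mul, twoPiI]
    push_cast
    rw [div_mul_div_comm, one_mul, ← mul_pow]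
  · refine Finset.sum_congr rfl fun i _ => ?_
    rw [← ee_natCast_mul, twoPiI]
    push_cast
    rw [div_mul_div_comm, one_mul, ← mul_pow]
    ring_nf

/-! ### Iterated integration by parts -/

lemma hasDerivAt_ee_div (n : ℤ) (w u : ℝ) :
    HasDerivAt (fun u : ℝ => ee (n * u / w)) (twoPiI n / w * ee (n * u / w)) u := by
  have h : HasDerivAt (fun u : ℝ => 2 * (Real.pi : ℂ) * Complex.I * (n * u / w))
      (2 * (Real.pi : ℂ) * Complex.I * (n * 1 / w)) u :=
    (((Complex.ofRealCLM.hasDerivAt (x := u)).const_mul (n : ℂ)).div_const (w : ℂ)).const_mul _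
  convert! h.cexp using 1
  simp only [twoPiI, ee]
  ring

lemma integral_mul_ee_eq {a b w : ℝ} (hab : a < b) (hw : w ≠ 0) {n : ℤ} (hn : n ≠ 0)
    {g g' : ℝ → ℂ} (hg : ∀ u ∈ Set.Icc a b, HasDerivWithinAt g (g' u) (Set.Icc a b) u)
    (hg' : ContinuousOn g' (Set.Icc a b)) :
    ∫ u in a..b, g u * ee (n * u / w)
      = w / twoPiI n * (g b * ee (n * b / w) - g a * ee (n * a / w))
        - w / twoPiI n * ∫ u in a..b, g' u * ee (n * u / w) := by
  have hw' : (w : ℂ) ≠ 0 := by exact_mod_cast hw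
  have ht := twoPiI_ne_zero hn
  have hcont : Continuous fun u : ℝ => ee (n * u / w) :=
    continuous_ee.comp (by fun_prop)
  have key := intervalIntegral.integral_mul_deriv_eq_deriv_mul_of_hasDerivWithinAt
    (u := g) (u' := g') (v := fun u : ℝ => w / twoPiI n * ee (n * u / w))
    (v' := fun u : ℝ => ee (n * u / w)) (a := a) (b := b)
    (by rwa [Set.uIcc_of_le hab.le])
    (fun u _ => by
      have := ((hasDerivAt_ee_div n w u).const_mul ((w : ℂ) / twoPiI n)).hasDerivWithinAt
        (s := Set.uIcc a b)
      convert! this using 1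
      field_simp)
    ((hg'.mono (by rw [Set.uIcc_of_le hab.le])).intervalIntegrable)
    (hcont.intervalIntegrable _ _)
  rw [key, ← intervalIntegral.integral_const_mul]
  congr 1
  · ring
  · exact intervalIntegral.integral_congr fun u _ => by ring

lemma integral_mul_ee_eq_sum_iteratedDerivWithin {a b w : ℝ} (hab : a < b) (hw : w ≠ 0) {n : ℤ}
    (hn : n ≠ 0) {f : ℝ → ℂ} (R : ℕ) (hf : ContDiffOn ℝ R f (Set.Icc a b)) :
    ∫ u in a..b, f u * ee (n * u / w)
      = ∑ r ∈ Finset.range R, (-1) ^ r * (w / twoPiI n) ^ (r + 1) *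
          (iteratedDerivWithin r f (Set.Icc a b) b * ee (n * b / w)
            - iteratedDerivWithin r f (Set.Icc a b) a * ee (n * a / w))
        + (-1) ^ R * (w / twoPiI n) ^ R *
          ∫ u in a..b, iteratedDerivWithin R f (Set.Icc a b) u * ee (n * u / w) := by
  induction R with
  | zero => simp
  | succ R ih =>
    have hU := uniqueDiffOn_Icc hab
    rw [ih (hf.of_le (by norm_cast; omega)), Finset.sum_range_succ,
      integral_mul_ee_eq hab hw hn (g := iteratedDerivWithin R f (Set.Icc a b))
        (g' := iteratedDerivWithin (R + 1) f (Set.Icc a b))]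
    · ring
    · intro u hu
      rw [iteratedDerivWithin_succ]
      exact (hf.differentiableOn_iteratedDerivWithin (by norm_cast; omega) hU u hu).hasDerivWithinAt
    · exact hf.continuousOn_iteratedDerivWithin (by norm_cast) hU

/-! ### Pointwise convergence of Fourier series and Poisson summation -/

lemma ee_sub_one_mul_sum (z : ℂ) (N : ℕ) :
    (ee z - 1) * ∑ n ∈ Finset.Icc (-(N : ℤ)) (N : ℤ), ee (n * z)
      = ee ((N + 1) * z) - ee (-N * z) := by
  rw [sum_Icc_symm_eq, sum_Icc_symm_erase_zero]
  induction N with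
  | zero => simp [ee_zero]
  | succ N ih =>
    rw [Finset.sum_range_succ, ← add_assoc, mul_add, ih]
    push_cast
    have h₁ : ee ((N + 1 + 1) * z) = ee ((N + 1) * z) * ee z := by rw [← ee_add]; ring_nf
    have h₂ : ee (-N * z) = ee (-(N + 1) * z) * ee z := by rw [← ee_add]; ring_nf
    rw [h₁, h₂]
    ring

lemma norm_ee_sub_one_ge {y : ℝ} (hy : |y| ≤ 1 / 2) : 4 * |y| ≤ ‖ee y - 1‖ := by
  have h : ee y = Complex.exp (Complex.I * (2 * Real.pi * y : ℝ)) := by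
    rw [ee]; push_cast; ring_nf
  rw [h, Complex.norm_exp_I_mul_ofReal_sub_one, Real.norm_eq_abs, abs_mul, abs_two,
    show 2 * Real.pi * y / 2 = Real.pi * y by ring]
  have hpi := Real.pi_pos
  have := Real.mul_abs_le_abs_sin (x := Real.pi * y)
    (by rw [abs_mul, abs_of_pos hpi]; nlinarith)
  rw [abs_mul, abs_of_pos hpi, ← mul_assoc, div_mul_cancel₀ _ hpi.ne'] at this
  linarith

lemma integral_ee_period (n : ℤ) :
    ∫ y in (-(1 / 2) : ℝ)..(1 / 2), ee (n * y) = if n = 0 then 1 else 0 := by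
  split_ifs with hn
  · subst hn
    simp [ee_zero]; norm_num
  · have hd : ∀ y ∈ Set.uIcc (-(1 / 2) : ℝ) (1 / 2),
        HasDerivAt (fun y : ℝ => ee (n * y) / twoPiI n) (ee (n * y)) y := by
      intro y _
      have := (hasDerivAt_ee_div n 1 y).div_const (twoPiI n)
      simpa [mul_div_cancel_left₀ _ (twoPiI_ne_zero hn)] using this
    have hcont : Continuous fun y : ℝ => ee (n * y) := continuous_ee.comp (by fun_prop)
    rw [integral_eq_sub_of_hasDerivAt hd (hcont.intervalIntegrable _ _), ← sub_div]
    have : ee (n * ((1 / 2 : ℝ) : ℂ)) = ee (n * ((-(1 / 2) : ℝ) : ℂ)) := by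
      rw [show (n * ((1 / 2 : ℝ) : ℂ)) = n * ((-(1 / 2) : ℝ) : ℂ) + n by push_cast; ring,
        ee_add, ee_intCast, mul_one]
    rw [this, sub_self, zero_div]

lemma sum_integral_ee_period (N : ℕ) :
    ∑ n ∈ Finset.Icc (-(N : ℤ)) (N : ℤ), ∫ y in (-(1 / 2) : ℝ)..(1 / 2), ee (n * y) = 1 := by
  simp_rw [integral_ee_period]
  simp

/-- Riemann–Lebesgue lemma for the functions `ee (t * y)`. -/
lemma tendsto_integral_mul_ee (q : ℝ → ℂ) (t : ℕ → ℝ) (ht : Tendsto t atTop (cocompact ℝ)) :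
    Tendsto (fun N => ∫ y : ℝ, q y * ee (t N * y)) atTop (nhds 0) := by
  have := (Real.tendsto_integral_exp_smul_cocompact q).comp
    ((Homeomorph.neg ℝ).isClosedEmbedding.tendsto_cocompact.comp ht)
  refine this.congr fun N => integral_congr_ae (ae_of_all _ fun y => ?_)
  simp only [Function.comp_apply, Homeomorph.coe_neg, Circle.smul_def, smul_eq_mul,
    Real.fourierChar_apply, ee]
  rw [mul_comm]
  congr 2
  push_cast
  ring

/-- Dini's criterion for the Fourier series of a function on a period, at the midpoint. -/
lemma tendsto_sum_integral_mul_ee_period {h : ℝ → ℂ}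
    (hm : AEStronglyMeasurable h volume) {C : ℝ}
    (hC : ∀ y : ℝ, |y| ≤ 1 / 2 → ‖h y - h 0‖ ≤ C * |y|) :
    Tendsto (fun N : ℕ => ∑ n ∈ Finset.Icc (-(N : ℤ)) (N : ℤ),
      ∫ y in (-(1 / 2) : ℝ)..(1 / 2), h y * ee (n * y)) atTop (nhds (h 0)) := by
  set I : Set ℝ := Set.Ioc (-(1 / 2)) (1 / 2) with hI
  have habs : ∀ y ∈ I, |y| ≤ 1 / 2 := fun y hy => abs_le.2 ⟨hy.1.le, hy.2⟩
  have hC0 : 0 ≤ C := by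
    have := (norm_nonneg _).trans (hC (1 / 2) (by rw [abs_of_pos]; norm_num))
    rw [abs_of_pos (by norm_num)] at this
    linarith
  set q : ℝ → ℂ := I.indicator fun y => (h y - h 0) / (ee y - 1) with hq
  have hemeas : Measurable fun y : ℝ => ee y := (continuous_ee.comp (by fun_prop)).measurable
  have hqm : AEStronglyMeasurable q volume :=
    AEStronglyMeasurable.indicator
      ((hm.sub aestronglyMeasurable_const).div₀
        (hemeas.sub measurable_const).aestronglyMeasurable) measurableSet_Ioc
  have hqb : ∀ y, ‖q y‖ ≤ C / 4 := by
    intro y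
    rw [hq, Set.indicator_apply]
    split_ifs with hy
    · have h1 := hC y (habs y hy)
      have h2 := norm_ee_sub_one_ge (habs y hy)
      rw [norm_div]
      refine div_le_of_le_mul₀ (norm_nonneg _) (by positivity) ?_
      nlinarith
    · simp; positivity
  have hqi : Integrable q volume := by
    refine IntegrableOn.integrable_of_forall_notMem_eq_zero (s := I) ?_ ?_
    · exact Measure.integrableOn_of_bounded (by simp [hI]) hqm
        (ae_of_all _ hqb)
    · intro y hy
      simp [hq, hy]
  have hqe : ∀ t : ℝ, Integrable (fun y : ℝ => q y * ee (t * y)) volume := by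
    intro t
    refine hqi.mul_bdd (c := 1) ?_ (ae_of_all _ fun y => ?_)
    · exact (continuous_ee.comp
        (by fun_prop : Continuous fun y : ℝ => (t * y : ℂ))).aestronglyMeasurable
    · rw [← Complex.ofReal_mul, norm_ee_ofReal]
  have hfac : ∀ y ∈ I, h y - h 0 = q y * (ee y - 1) := by
    intro y hy
    rw [hq, Set.indicator_of_mem hy]
    by_cases hy0 : y = 0
    · subst hy0; simp
    · have h2 := norm_ee_sub_one_ge (habs y hy)
      have : ee y - 1 ≠ 0 := by
        intro h0
        rw [h0, norm_zero] at h2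
        have := abs_pos.2 hy0
        linarith
      rw [div_mul_cancel₀ _ this]
  have h_integral : IntervalIntegrable (fun y => h y - h 0) volume (-(1 / 2)) (1 / 2) := by
    rw [intervalIntegrable_iff_integrableOn_Ioc_of_le (by norm_num)]
    refine Measure.integrableOn_of_bounded (M := C * (1 / 2)) (by simp)
      (hm.sub aestronglyMeasurable_const) ?_
    rw [ae_restrict_iff' measurableSet_Ioc]
    refine ae_of_all _ fun y hy => (hC y (habs y hy)).trans ?_
    exact mul_le_mul_of_nonneg_left (habs y hy) hC0
  have hecont : ∀ n : ℤ, Continuous fun y : ℝ => ee (n * y) :=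
    fun n => continuous_ee.comp (by fun_prop)
  have key : ∀ N : ℕ, ∑ n ∈ Finset.Icc (-(N : ℤ)) (N : ℤ),
      ∫ y in (-(1 / 2) : ℝ)..(1 / 2), h y * ee (n * y)
      = h 0 + ((∫ y : ℝ, q y * ee ((N + 1 : ℝ) * y)) - ∫ y : ℝ, q y * ee ((-N : ℝ) * y)) := by
    intro N
    have e1 : ∀ n : ℤ, ∫ y in (-(1 / 2) : ℝ)..(1 / 2), h y * ee (n * y)
        = (∫ y in (-(1 / 2) : ℝ)..(1 / 2), (h y - h 0) * ee (n * y))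
          + h 0 * ∫ y in (-(1 / 2) : ℝ)..(1 / 2), ee (n * y) := by
      intro n
      rw [← intervalIntegral.integral_const_mul, ← intervalIntegral.integral_add]
      · exact intervalIntegral.integral_congr fun y _ => by ring
      · exact h_integral.mul_continuousOn (hecont n).continuousOn
      · exact (((hecont n).const_smul (h 0))).intervalIntegrable _ _
    simp_rw [e1, Finset.sum_add_distrib, ← Finset.mul_sum, sum_integral_ee_period, mul_one]
    rw [add_comm, ← intervalIntegral.integral_finsetSum
      (fun n _ => h_integral.mul_continuousOn (hecont n).continuousOn)]
    congr 1
    rw [← integral_sub (by simpa using hqe (N + 1)) (by simpa using hqe (-N)),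
      intervalIntegral.integral_of_le (by norm_num),
      ← MeasureTheory.integral_indicator measurableSet_Ioc]
    refine integral_congr_ae (ae_of_all _ fun y => ?_)
    dsimp only
    rw [Set.indicator_apply]
    split_ifs with hy
    · rw [← Finset.mul_sum, hfac y hy, mul_assoc, ee_sub_one_mul_sum, mul_sub]
      push_cast
      rfl
    · have : q y = 0 := by rw [hq, Set.indicator_of_notMem hy]
      simp [this]
  simp_rw [key]
  have t1 : Tendsto (fun N : ℕ => (N : ℝ) + 1) atTop (cocompact ℝ) :=
    (tendsto_atTop_add_const_right _ _ tendsto_natCast_atTop_atTop).mono_right atTop_le_cocompact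
  have t2 : Tendsto (fun N : ℕ => -(N : ℝ)) atTop (cocompact ℝ) :=
    (tendsto_neg_atTop_atBot.comp tendsto_natCast_atTop_atTop).mono_right atBot_le_cocompact
  have := ((tendsto_integral_mul_ee q _ t1).sub (tendsto_integral_mul_ee q _ t2)).const_add (h 0)
  simpa using this

lemma exists_norm_sub_le_mul_abs {G : ℝ → ℂ} {B : ℝ} (hB : ∀ y, ‖G y‖ ≤ B) {x : ℝ}
    (hd : DifferentiableAt ℝ G x) : ∃ C, ∀ y, ‖G (y + x) - G x‖ ≤ C * |y| := by
  obtain ⟨C, hC⟩ := hd.isBigO_sub.bound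
  obtain ⟨ε, hε, hball⟩ := Metric.eventually_nhds_iff.1 hC
  have hB0 : 0 ≤ B := (norm_nonneg _).trans (hB 0)
  refine ⟨max C (2 * B / ε), fun y => ?_⟩
  by_cases hy : |y| < ε
  · have := hball (y := y + x) (by simpa [Real.dist_eq] using hy)
    rw [add_sub_cancel_right, Real.norm_eq_abs] at this
    exact this.trans (mul_le_mul_of_nonneg_right (le_max_left _ _) (abs_nonneg _))
  · push Not at hy
    calc ‖G (y + x) - G x‖ ≤ B + B := (norm_sub_le _ _).trans (add_le_add (hB _) (hB _))
      _ = 2 * B / ε * ε := by field_simp; ring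
      _ ≤ max C (2 * B / ε) * |y| := by
        gcongr
        exact le_max_right _ _

/-- Poisson summation for a bounded compactly supported function which is differentiable at every
integer. -/
lemma tendsto_sum_integral_mul_ee {G : ℝ → ℂ} (hm : AEStronglyMeasurable G volume) {B : ℝ}
    (hB : ∀ y, ‖G y‖ ≤ B) (p : ℤ) (M : ℕ)
    (hsupp : ∀ y, y ∉ Set.Ioc ((p : ℝ) - 1 / 2) (p + M - 1 / 2) → G y = 0)
    (hd : ∀ j : ℤ, DifferentiableAt ℝ G j) :
    Tendsto (fun N : ℕ => ∑ n ∈ Finset.Icc (-(N : ℤ)) (N : ℤ), ∫ y : ℝ, G y * ee (n * y))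
      atTop (nhds (∑ i ∈ Finset.range M, G ((p + i : ℤ) : ℝ))) := by
  have hlim : ∀ i ∈ Finset.range M, Tendsto (fun N : ℕ => ∑ n ∈ Finset.Icc (-(N : ℤ)) (N : ℤ),
      ∫ y in (-(1 / 2) : ℝ)..(1 / 2), G (y + (p + i : ℤ)) * ee (n * y))
      atTop (nhds (G ((p + i : ℤ) : ℝ))) := by
    intro i _
    obtain ⟨C, hC⟩ := exists_norm_sub_le_mul_abs hB (hd (p + i))
    have := tendsto_sum_integral_mul_ee_period (h := fun y => G (y + (p + i : ℤ))) (C := C)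
      (hm.comp_measurePreserving (measurePreserving_add_right volume _))
      (fun y _ => by simpa using hC y)
    simpa using this
  refine (tendsto_finsetSum _ hlim).congr fun N => ?_
  rw [Finset.sum_comm]
  refine Finset.sum_congr rfl fun n _ => ?_
  have hecont : Continuous fun y : ℝ => ee (n * y) := continuous_ee.comp (by fun_prop)
  have hGi : Integrable G volume := by
    refine IntegrableOn.integrable_of_forall_notMem_eq_zero ?_ hsupp
    exact Measure.integrableOn_of_bounded (by simp) hm (ae_of_all _ hB)
  have h_integral : Integrable (fun y => G y * ee (n * y)) volume := by
    refine hGi.mul_bdd (c := 1) hecont.aestronglyMeasurable (ae_of_all _ fun y => ?_)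
    rw [← Complex.ofReal_intCast, ← Complex.ofReal_mul, norm_ee_ofReal]
  have hshift : ∀ i : ℕ, ∫ y in (-(1 / 2) : ℝ)..(1 / 2), G (y + (p + i : ℤ)) * ee (n * y)
      = ∫ y in ((p : ℝ) + i - 1 / 2)..(p + (i + 1 : ℕ) - 1 / 2), G y * ee (n * y) := by
    intro i
    have := intervalIntegral.integral_comp_add_right (a := (-(1 / 2) : ℝ)) (b := 1 / 2)
      (fun y => G y * ee (n * y)) ((p + i : ℤ) : ℝ)
    rw [show (p : ℝ) + i - 1 / 2 = -(1 / 2) + ((p + i : ℤ) : ℝ) by push_cast; ring,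
      show (p : ℝ) + (i + 1 : ℕ) - 1 / 2 = 1 / 2 + ((p + i : ℤ) : ℝ) by push_cast; ring, ← this]
    refine intervalIntegral.integral_congr fun y _ => ?_
    rw [show (n : ℂ) * ((y + ((p + i : ℤ) : ℝ) : ℝ) : ℂ) = n * y + ((n * (p + i) : ℤ) : ℂ) by
      push_cast; ring, ee_add, ee_intCast, mul_one]
  simp_rw [hshift]
  rw [intervalIntegral.sum_integral_adjacent_intervals
    (a := fun i : ℕ => (p : ℝ) + i - 1 / 2) (fun i _ => h_integral.intervalIntegrable),
    intervalIntegral.integral_of_le (by push_cast; linarith [Nat.cast_nonneg (α := ℝ) M])]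
  refine setIntegral_eq_integral_of_forall_compl_eq_zero fun y hy => ?_
  rw [hsupp y (by simpa using hy), zero_mul]

/-- Poisson summation for a `C¹` function on a compact interval whose endpoints avoid the
progression `w * (ℤ + c)`. -/
lemma tendsto_sum_ee_mul_integral {a b w c : ℝ} (hw : 0 < w) {f : ℝ → ℂ}
    (hab : a < b) (hf : ContDiffOn ℝ 1 f (Set.Icc a b)) (ha : ∀ j : ℤ, a ≠ w * (j + c))
    (hb : ∀ j : ℤ, b ≠ w * (j + c)) (p : ℤ) (M : ℕ) (hp : w * (p - 1 / 2 + c) ≤ a)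
    (hM : b ≤ w * (p + M - 1 / 2 + c)) :
    Tendsto (fun N : ℕ => ∑ n ∈ Finset.Icc (-(N : ℤ)) (N : ℤ),
        1 / (w : ℂ) * (ee (-n * c) * ∫ u in a..b, f u * ee (n * u / w))) atTop
      (nhds (∑ i ∈ Finset.range M, (Set.Ioc a b).indicator f (w * ((p + i : ℤ) + c)))) := by
  have hwC : (w : ℂ) ≠ 0 := by exact_mod_cast hw.ne'
  set F : ℝ → ℂ := (Set.Ioc a b).indicator f with hF
  have hFm : AEStronglyMeasurable F volume :=
    (aestronglyMeasurable_indicator_iff measurableSet_Ioc).2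
      ((hf.continuousOn.mono Set.Ioc_subset_Icc_self).aestronglyMeasurable measurableSet_Ioc)
  obtain ⟨B, hB⟩ := isCompact_Icc.exists_bound_of_continuousOn hf.continuousOn
  have hB0 : 0 ≤ B := (norm_nonneg _).trans (hB a ⟨le_rfl, hab.le⟩)
  have hFb : ∀ u, ‖F u‖ ≤ B := by
    intro u
    rw [hF, Set.indicator_apply]
    split_ifs with hu
    · exact hB u (Set.Ioc_subset_Icc_self hu)
    · simpa using hB0
  have hFd : ∀ u, u ≠ a → u ≠ b → DifferentiableAt ℝ F u := by
    intro u hua hub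
    by_cases hu : u ∈ Set.Icc a b
    · have hu' : u ∈ Set.Ioo a b := ⟨lt_of_le_of_ne hu.1 (Ne.symm hua), lt_of_le_of_ne hu.2 hub⟩
      have hfd := (hf.differentiableOn one_ne_zero).differentiableAt (Icc_mem_nhds hu'.1 hu'.2)
      refine hfd.congr_of_eventuallyEq ?_
      filter_upwards [isOpen_Ioo.mem_nhds hu'] with v hv
      exact Set.indicator_of_mem (Set.Ioo_subset_Ioc_self hv) f
    · refine (differentiableAt_const (0 : ℂ)).congr_of_eventuallyEq ?_
      filter_upwards [isClosed_Icc.isOpen_compl.mem_nhds hu] with v hv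
      exact Set.indicator_of_notMem (fun h => hv (Set.Ioc_subset_Icc_self h)) f
  have hqmp : Measure.QuasiMeasurePreserving (fun y : ℝ => w * (y + c)) volume volume := by
    have h1 : Measure.QuasiMeasurePreserving (fun y : ℝ => w * y) volume volume := by
      refine ⟨by fun_prop, ?_⟩
      rw [Real.map_volume_mul_left hw.ne']
      exact Measure.smul_absolutelyContinuous
    exact h1.comp (measurePreserving_add_right volume c).quasiMeasurePreserving
  have key := tendsto_sum_integral_mul_ee (G := fun y => F (w * (y + c)))
    (hFm.comp_quasiMeasurePreserving hqmp) (fun y => hFb _) p M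
    (by
      intro y hy
      refine Set.indicator_of_notMem (fun h => hy ⟨?_, ?_⟩) f
      · have := lt_of_mul_lt_mul_left (hp.trans_lt h.1) hw.le
        linarith
      · have := le_of_mul_le_mul_left (h.2.trans hM) hw
        linarith)
    (fun j => DifferentiableAt.comp (j : ℝ) (f := fun y : ℝ => w * (y + c))
      (hFd _ (ha j).symm (hb j).symm) (by fun_prop))
  refine key.congr fun N => Finset.sum_congr rfl fun n _ => ?_
  have h1 := integral_add_right_eq_self (μ := volume)
    (fun y : ℝ => F (w * y) * ee (n * ((y : ℂ) - c))) c
  have h2 := Measure.integral_comp_mul_left (fun u : ℝ => F u * ee (n * ((u : ℂ) / w - c))) w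
  have h3 : ∀ y : ℝ, (((w * y : ℝ) : ℂ) / w) = y := fun y => by
    push_cast; field_simp
  have h4 : ∀ y : ℝ, ((y + c : ℝ) : ℂ) - c = y := fun y => by push_cast; ring
  simp only [h3] at h2
  simp only [h4] at h1
  rw [h1, h2, abs_of_pos (inv_pos.2 hw), Complex.real_smul, intervalIntegral.integral_of_le hab.le,
    ← MeasureTheory.integral_const_mul (ee (-n * c)),
    ← MeasureTheory.integral_indicator measurableSet_Ioc]
  congr 1
  · push_cast; ring
  · refine integral_congr_ae (ae_of_all _ fun u => ?_)
    dsimp only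
    rw [hF, Set.indicator_apply, Set.indicator_apply]
    split_ifs
    · rw [show (n : ℂ) * (u / w - c) = -n * c + n * u / w by ring, ee_add]
      ring
    · simp

/-! ### Residue classes and divisors -/

lemma sum_residue_class_eq {k : ℕ} (hk : 1 ≤ k) (S : Finset ℤ) (X : ℤ → ℂ) :
    ∑ r ∈ Finset.Icc (1 : ℤ) k, ∑ m ∈ S.filter (fun m => m % (k : ℤ) = r % (k : ℤ)), X m
      = ∑ m ∈ S, X m := by
  have hk0 : (0 : ℤ) < k := by exact_mod_cast hk
  rw [← Finset.sum_fiberwise_of_maps_to (s := S) (t := Finset.Icc (1 : ℤ) k)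
    (g := fun m => (m - 1) % (k : ℤ) + 1)]
  · refine Finset.sum_congr rfl fun r hr => Finset.sum_congr ?_ fun _ _ => rfl
    rw [Finset.mem_Icc] at hr
    refine Finset.filter_congr fun m _ => ?_
    have h1 : (r - 1) % (k : ℤ) = r - 1 := Int.emod_eq_of_lt (by omega) (by omega)
    constructor
    · intro h
      have : (m - 1) % (k : ℤ) = (r - 1) % (k : ℤ) := Int.ModEq.sub_right 1 h
      omega
    · intro h
      have : m - 1 ≡ r - 1 [ZMOD k] := by rw [Int.ModEq, h1]; omega
      have h' : m ≡ r [ZMOD k] := by simpa using this.add_right 1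
      exact h'
  · intro m _
    have := Int.emod_nonneg (m - 1) hk0.ne'
    have := Int.emod_lt_of_pos (m - 1) hk0
    rw [Finset.mem_Icc]
    omega

lemma sum_progression_eq {k : ℕ} (hk : 1 ≤ k) {m r A : ℤ} (hm : 1 ≤ m)
    (hr : r ∈ Finset.Icc (1 : ℤ) k) {F : ℤ → ℂ} (hF : ∀ x, F x ≠ 0 → 1 ≤ x ∧ x ≤ A) :
    ∑ i ∈ Finset.range (A.toNat + 3), F (m * (k * (-1 + i) + r))
      = ∑ l ∈ (Finset.Icc 1 A).filter (fun l => l % (k : ℤ) = r % (k : ℤ)), F (m * l) := by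
  have hk0 : (0 : ℤ) < k := by exact_mod_cast hk
  rw [Finset.mem_Icc] at hr
  have hrep : ∀ l ∈ (Finset.Icc 1 A).filter (fun l => l % (k : ℤ) = r % (k : ℤ)),
      ∃ i : ℕ, i < A.toNat + 3 ∧ ((l - r) / k + 1).toNat = i ∧ l = k * (-1 + i) + r := by
    intro l hl
    rw [Finset.mem_filter, Finset.mem_Icc] at hl
    obtain ⟨⟨hl1, hlA⟩, hmod⟩ := hl
    obtain ⟨q, hq⟩ : (k : ℤ) ∣ l - r := Int.ModEq.dvd (Int.ModEq.symm hmod)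
    have hq0 : 0 ≤ q := by
      by_contra! h
      have : (k : ℤ) * q ≤ k * (-1) := mul_le_mul_of_nonneg_left (by omega) hk0.le
      omega
    have hqk : q ≤ k * q := le_mul_of_one_le_left hq0 (by omega)
    refine ⟨(q + 1).toNat, by omega, ?_, ?_⟩
    · rw [hq, Int.mul_ediv_cancel_left _ hk0.ne']
    · rw [Int.toNat_of_nonneg (by omega)]
      linear_combination hq
  symm
  refine Finset.sum_of_injOn (fun l => ((l - r) / k + 1).toNat) ?_ ?_ ?_ ?_
  · intro l hl l' hl' h
    obtain ⟨i, _, hi, hli⟩ := hrep l hl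
    obtain ⟨i', _, hi', hli'⟩ := hrep l' hl'
    dsimp only at h
    rw [hi, hi'] at h
    rw [hli, hli', h]
  · intro l hl
    obtain ⟨i, hi, hi', _⟩ := hrep l hl
    simpa [hi'] using hi
  · intro i _ hni
    by_contra hne
    obtain ⟨h1, h2⟩ := hF _ hne
    have hl1 : 1 ≤ (k : ℤ) * (-1 + i) + r := by
      by_contra! h
      have : m * ((k : ℤ) * (-1 + i) + r) ≤ 0 :=
        mul_nonpos_of_nonneg_of_nonpos (by omega) (by omega)
      omega
    have hlA : (k : ℤ) * (-1 + i) + r ≤ A := (le_mul_of_one_le_left (by omega) hm).trans h2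
    refine hni ⟨k * (-1 + i) + r, ?_, ?_⟩
    · simp only [Finset.coe_filter, Set.mem_ofPred_eq, Finset.mem_Icc]
      refine ⟨⟨hl1, hlA⟩, ?_⟩
      rw [add_comm, Int.add_mul_emod_self_left]
    · dsimp only
      rw [add_sub_cancel_right, Int.mul_ediv_cancel_left _ hk0.ne']
      omega
  · intro l hl
    obtain ⟨i, _, hi', hli⟩ := hrep l hl
    rw [hi', ← hli]

lemma card_filter_dvd_Icc {n A : ℤ} (hn : 1 ≤ n) (hnA : n ≤ A) :
    ((Finset.Icc 1 A).filter (fun m => m ∣ n)).card = n.toNat.divisors.card := by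
  refine Finset.card_nbij' Int.toNat (fun d => (d : ℤ)) ?_ ?_ ?_ ?_
  · intro m hm
    simp only [Finset.coe_filter, Set.mem_ofPred_eq, Finset.mem_Icc] at hm
    simp only [Finset.mem_coe, Nat.mem_divisors]
    refine ⟨?_, by omega⟩
    rw [← Int.natCast_dvd_natCast, Int.toNat_of_nonneg (by omega), Int.toNat_of_nonneg (by omega)]
    exact hm.2
  · intro d hd
    simp only [Finset.mem_coe, Nat.mem_divisors] at hd
    simp only [Finset.coe_filter, Set.mem_ofPred_eq, Finset.mem_Icc]
    have h := Nat.le_of_dvd (by omega) hd.1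
    have h0 := Nat.pos_of_dvd_of_pos hd.1 (by omega)
    refine ⟨by omega, ?_⟩
    rw [← Int.natCast_dvd_natCast, Int.toNat_of_nonneg (by omega)] at hd
    exact hd.1
  · intro m hm
    simp only [Finset.coe_filter, Set.mem_ofPred_eq, Finset.mem_Icc] at hm
    exact Int.toNat_of_nonneg (by omega)
  · intro d _
    simp

lemma sum_mul_card_divisors_eq {A₀ A : ℤ} (hA₀ : 0 ≤ A₀) {H : ℤ → ℂ}
    (hH : ∀ x, H x ≠ 0 → x ∈ Finset.Ioc A₀ A) :
    ∑ n ∈ Finset.Ioc A₀ A, (n.toNat.divisors.card : ℂ) * H n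
      = ∑ m ∈ Finset.Icc 1 A, ∑ l ∈ Finset.Icc 1 A, H (m * l) := by
  have h1 : ∀ m ∈ Finset.Icc 1 A, ∑ l ∈ Finset.Icc 1 A, H (m * l)
      = ∑ n ∈ (Finset.Ioc A₀ A).filter (fun n => m ∣ n), H n := by
    intro m hm
    rw [Finset.mem_Icc] at hm
    symm
    refine Finset.sum_of_injOn (fun n => n / m) ?_ ?_ ?_ ?_
    · intro n hn n' hn' h
      simp only [Finset.coe_filter, Set.mem_ofPred_eq] at hn hn'
      dsimp only at h
      rw [← Int.mul_ediv_cancel' hn.2, ← Int.mul_ediv_cancel' hn'.2, h]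
    · intro n hn
      simp only [Finset.coe_filter, Set.mem_ofPred_eq, Finset.mem_Ioc] at hn
      obtain ⟨hn, q, rfl⟩ := hn
      simp only [Finset.coe_Icc, Set.mem_Icc]
      rw [Int.mul_ediv_cancel_left _ (by omega)]
      have hq : 0 < q := by
        by_contra! h
        have : m * q ≤ 0 := mul_nonpos_of_nonneg_of_nonpos (by omega) h
        omega
      exact ⟨by omega, (le_mul_of_one_le_left hq.le hm.1).trans hn.2⟩
    · intro l _ hnl
      by_contra hne
      refine hnl ⟨m * l, ?_, Int.mul_ediv_cancel_left _ (by omega)⟩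
      simpa using hH _ hne
    · intro n hn
      rw [Finset.mem_filter] at hn
      rw [Int.mul_ediv_cancel' hn.2]
  rw [Finset.sum_congr rfl h1]
  simp_rw [Finset.sum_filter]
  rw [Finset.sum_comm]
  refine Finset.sum_congr rfl fun n hn => ?_
  rw [Finset.mem_Ioc] at hn
  rw [← Finset.sum_filter, Finset.sum_const, card_filter_dvd_Icc (by omega) hn.2, nsmul_eq_mul]

lemma sum_weight_mul_card_divisors_eq {k : ℕ} (hk : 1 ≤ k) {χ : ℤ → ℂ}
    (hχ : Function.Periodic χ (k : ℤ)) {A₀ A : ℤ} (hA₀ : 0 ≤ A₀) {F : ℤ → ℂ}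
    (hF : ∀ x, F x ≠ 0 → x ∈ Finset.Ioc A₀ A) :
    ∑ n ∈ Finset.Ioc A₀ A, χ n * (n.toNat.divisors.card : ℂ) * F n
      = ∑ r₁ ∈ Finset.Icc (1 : ℤ) k, ∑ r₂ ∈ Finset.Icc (1 : ℤ) k, χ (r₁ * r₂) *
          ∑ m ∈ (Finset.Icc 1 A).filter (fun m => m % (k : ℤ) = r₁ % (k : ℤ)),
            ∑ l ∈ (Finset.Icc 1 A).filter (fun l => l % (k : ℤ) = r₂ % (k : ℤ)), F (m * l) := by
  have hcongr : ∀ x y : ℤ, x ≡ y [ZMOD k] → χ x = χ y := by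
    intro x y h
    obtain ⟨q, hq⟩ := h.symm.dvd
    have := hχ.int_mul q y
    rw [← this]
    congr 1
    linear_combination hq
  have h := sum_mul_card_divisors_eq hA₀ (H := fun n => χ n * F n) (A := A)
    (fun x hx => hF x (right_ne_zero_of_mul hx))
  calc _ = ∑ n ∈ Finset.Ioc A₀ A, (n.toNat.divisors.card : ℂ) * (χ n * F n) :=
        Finset.sum_congr rfl fun n _ => by ring
    _ = _ := h
    _ = _ := by
      rw [← sum_residue_class_eq hk]
      refine Finset.sum_congr rfl fun r₁ _ => ?_
      simp_rw [Finset.mul_sum]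
      rw [Finset.sum_comm (s := Finset.Icc (1 : ℤ) k)]
      refine Finset.sum_congr rfl fun m hm => ?_
      rw [← sum_residue_class_eq hk]
      refine Finset.sum_congr rfl fun r₂ _ => Finset.sum_congr rfl fun l hl => ?_
      rw [Finset.mem_filter] at hm hl
      rw [hcongr (m * l) (r₁ * r₂) (Int.ModEq.mul hm.2 hl.2)]

/-! ### Assembly -/

lemma ofReal_ne_intCast_of_ne {k : ℕ} (hk : 1 ≤ k) {m : ℤ} (hm : 1 ≤ m) {x : ℝ}
    (hx : ∀ n : ℤ, x ≠ n) (r j : ℤ) : x ≠ (m : ℝ) * k * (j + (r : ℝ) / k) := by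
  intro h
  have hk0 : (k : ℝ) ≠ 0 := by positivity
  refine hx (m * (k * j + r)) ?_
  rw [h]
  push_cast
  field_simp

lemma exists_symTendsto_boundary {k : ℕ} (hk : 1 ≤ k) {S : Finset ℤ} (hS : ∀ m ∈ S, 1 ≤ m)
    {x : ℝ} (hx : ∀ n : ℤ, x ≠ n) (r : ℕ) (r₂ : ℤ) :
    ∃ L, SymTendsto (fun n => ee (-(n : ℂ) * (r₂ : ℂ) / (k : ℂ)) / (twoPiI n) ^ (r + 1) *
      ∑ m ∈ S, (m : ℂ) ^ r * ee ((n : ℂ) * (x : ℂ) / ((m : ℂ) * (k : ℂ)))) L := by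
  have h : ∀ m : ℤ, ∃ L, m ∈ S → SymTendsto
      (fun n => ee (n * ((x / (m * k) - r₂ / k : ℝ) : ℂ)) / twoPiI n ^ (r + 1)) L := by
    intro m
    by_cases hm : m ∈ S
    · obtain ⟨L, hL⟩ := exists_symTendsto_ee_div_pow (x := x / (m * k) - r₂ / k)
        (fun j hj => by
          have hm0 : (m : ℝ) ≠ 0 := by
            have := hS m hm
            exact_mod_cast (by omega : m ≠ 0)
          have hk0 : (k : ℝ) ≠ 0 := by positivity
          refine ofReal_ne_intCast_of_ne hk (hS m hm) hx r₂ j ?_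
          rw [← hj]
          field_simp
          ring) r
      exact ⟨L, fun _ => hL⟩
    · exact ⟨0, fun h => absurd h hm⟩
  choose L hL using h
  refine ⟨∑ m ∈ S, (m : ℂ) ^ r * L m,
    (SymTendsto.sum S fun m hm => (hL m hm).const_mul ((m : ℂ) ^ r)).congr fun n _ => ?_⟩
  rw [Finset.mul_sum]
  refine Finset.sum_congr rfl fun m _ => ?_
  rw [show (n : ℂ) * ((x / (m * k) - r₂ / k : ℝ) : ℂ)
    = -(n : ℂ) * r₂ / k + n * x / (m * k) by push_cast; ring, ee_add]
  ring

lemma symTendsto_progression {k : ℕ} (hk : 1 ≤ k) {a b : ℝ} (ha0 : 0 ≤ a) (hab : a < b)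
    (ha : ∀ n : ℤ, a ≠ n) (hb : ∀ n : ℤ, b ≠ n) {f : ℝ → ℂ}
    (hf : ContDiffOn ℝ 1 f (Set.Icc a b)) {m : ℤ} (hm : 1 ≤ m) {r₂ : ℤ}
    (hr₂ : r₂ ∈ Finset.Icc (1 : ℤ) k) :
    SymTendsto (fun n => 1 / ((m : ℂ) * k) *
        (ee (-(n : ℂ) * r₂ / k) * ∫ u in a..b, f u * ee (n * u / (m * k))))
      (∑ l ∈ (Finset.Icc 1 ⌊b⌋).filter (fun l => l % (k : ℤ) = r₂ % (k : ℤ)),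
          (Set.Ioc a b).indicator f ((m * l : ℤ) : ℝ)
        - 1 / ((m : ℂ) * k) * ∫ u in a..b, f u) := by
  have hkR : (1 : ℝ) ≤ k := by exact_mod_cast hk
  have hmR : (1 : ℝ) ≤ m := by exact_mod_cast hm
  have hw1 : (1 : ℝ) ≤ m * k := by nlinarith
  have hr := Finset.mem_Icc.1 hr₂
  have hrR0 : (0 : ℝ) ≤ r₂ / k := by
    have : (0 : ℝ) ≤ r₂ := by exact_mod_cast (by omega : (0 : ℤ) ≤ r₂)
    positivity
  have hrR1 : (r₂ : ℝ) / k ≤ 1 := by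
    rw [div_le_one (by linarith)]
    exact_mod_cast hr.2
  have hfl : b ≤ (⌊b⌋.toNat : ℝ) + 1 := by
    have h1 := (Int.lt_floor_add_one b).le
    have h2 : (⌊b⌋ : ℝ) ≤ (⌊b⌋.toNat : ℝ) := by exact_mod_cast Int.self_le_toNat ⌊b⌋
    linarith
  have key := tendsto_sum_ee_mul_integral (w := (m : ℝ) * k) (c := (r₂ : ℝ) / k) (by linarith)
    hab hf (ofReal_ne_intCast_of_ne hk hm ha r₂) (ofReal_ne_intCast_of_ne hk hm hb r₂)
    (-1) (⌊b⌋.toNat + 3)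
    (by
      push_cast
      nlinarith)
    (by
      push_cast
      have : (⌊b⌋.toNat : ℝ) + 1 ≤ -1 + (⌊b⌋.toNat + 3) - 1 / 2 + r₂ / k := by linarith
      nlinarith [Nat.cast_nonneg (α := ℝ) ⌊b⌋.toNat])
  have hpts : ∀ i : ℕ, (m : ℝ) * k * (((-1 + i : ℤ) : ℝ) + (r₂ : ℝ) / k)
      = ((m * (k * (-1 + i) + r₂) : ℤ) : ℝ) := by
    intro i
    push_cast
    field_simp
  simp_rw [hpts] at key
  rw [sum_progression_eq hk hm hr₂ (A := ⌊b⌋)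
    (F := fun x : ℤ => (Set.Ioc a b).indicator f (x : ℝ))
    (fun x hx => by
      have := Set.mem_of_indicator_ne_zero hx
      have hpos : (0 : ℝ) < x := ha0.trans_lt this.1
      exact ⟨by exact_mod_cast hpos, Int.le_floor.2 this.2⟩)] at key
  unfold SymTendsto
  refine (key.sub_const (1 / ((m : ℂ) * k) * ∫ u in a..b, f u)).congr fun N => ?_
  rw [sum_Icc_symm_eq]
  push_cast
  simp only [neg_zero, zero_mul, zero_div, ee_zero, mul_one, one_mul, mul_div_assoc]
  rw [add_sub_cancel_left]

lemma sum_mul_integral_eq {k : ℕ} (hk : 1 ≤ k) {a b : ℝ} (hab : a < b) {f : ℝ → ℂ} {R : ℕ}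
    (hf : ContDiffOn ℝ (R + 1) f (Set.Icc a b)) {S : Finset ℤ} (hS : ∀ m ∈ S, 1 ≤ m)
    {n : ℤ} (hn : n ≠ 0) (E : ℂ) :
    ∑ m ∈ S, 1 / ((m : ℂ) * k) * (E * ∫ u in a..b, f u * ee (n * u / (m * k)))
      = ∑ r ∈ Finset.range (R + 1), (-1 : ℂ) ^ r * (k : ℂ) ^ r *
          (iteratedDerivWithin r f (Set.Icc a b) b *
              (E / twoPiI n ^ (r + 1) * ∑ m ∈ S, (m : ℂ) ^ r * ee (n * b / (m * k)))
            - iteratedDerivWithin r f (Set.Icc a b) a *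
              (E / twoPiI n ^ (r + 1) * ∑ m ∈ S, (m : ℂ) ^ r * ee (n * a / (m * k))))
        + (-1 : ℂ) ^ (R + 1) * (k : ℂ) ^ R *
          (E / twoPiI n ^ (R + 1) *
            ∫ u in a..b, iteratedDerivWithin (R + 1) f (Set.Icc a b) u *
              ∑ m ∈ S, (m : ℂ) ^ R * ee (n * u / (m * k))) := by
  have hcont : ContinuousOn (iteratedDerivWithin (R + 1) f (Set.Icc a b)) (Set.Icc a b) :=
    hf.continuousOn_iteratedDerivWithin (by norm_cast) (uniqueDiffOn_Icc hab)
  have h_integral : ∫ u in a..b, iteratedDerivWithin (R + 1) f (Set.Icc a b) u *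
        ∑ m ∈ S, (m : ℂ) ^ R * ee (n * u / (m * k))
      = ∑ m ∈ S, (m : ℂ) ^ R *
        ∫ u in a..b, iteratedDerivWithin (R + 1) f (Set.Icc a b) u * ee (n * u / (m * k)) := by
    simp_rw [← intervalIntegral.integral_const_mul]
    rw [← intervalIntegral.integral_finsetSum]
    · refine intervalIntegral.integral_congr fun u _ => ?_
      rw [Finset.mul_sum]
      exact Finset.sum_congr rfl fun m _ => by ring
    · intro m _
      refine ContinuousOn.intervalIntegrable ?_
      rw [Set.uIcc_of_le hab.le]
      exact continuousOn_const.mul (hcont.mul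
        (continuous_ee.comp
          (by fun_prop : Continuous fun u : ℝ => (n * u / (m * k) : ℂ))).continuousOn)
  rw [h_integral]
  simp_rw [Finset.mul_sum, ← Finset.sum_sub_distrib]
  simp_rw [Finset.mul_sum]
  rw [Finset.sum_comm (s := Finset.range (R + 1)), ← Finset.sum_add_distrib]
  refine Finset.sum_congr rfl fun m hm => ?_
  have hm0 : (m : ℝ) ≠ 0 := by
    have := hS m hm
    exact_mod_cast (by omega : m ≠ 0)
  have hk0 : (k : ℝ) ≠ 0 := by positivity
  have hm0' : (m : ℂ) ≠ 0 := by exact_mod_cast hm0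
  have hk0' : (k : ℂ) ≠ 0 := by exact_mod_cast hk0
  have key := integral_mul_ee_eq_sum_iteratedDerivWithin hab (mul_ne_zero hm0 hk0) hn (R + 1)
    (by exact_mod_cast hf)
  push_cast at key
  rw [key, mul_add, mul_add, Finset.mul_sum, Finset.mul_sum]
  have ht := twoPiI_ne_zero hn
  congr 1
  · refine Finset.sum_congr rfl fun r _ => ?_
    rw [div_pow, mul_pow]
    field_simp
    ring
  · rw [div_pow, mul_pow]
    field_simp
    ring

lemma symTendsto_remainder {k : ℕ} (hk : 1 ≤ k) {a b : ℝ} (ha0 : 0 ≤ a) (hab : a < b)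
    (ha : ∀ n : ℤ, a ≠ n) (hb : ∀ n : ℤ, b ≠ n) {f : ℝ → ℂ} {R : ℕ}
    (hf : ContDiffOn ℝ (R + 1) f (Set.Icc a b)) {S : Finset ℤ} (hS : ∀ m ∈ S, 1 ≤ m) {r₂ : ℤ}
    (hr₂ : r₂ ∈ Finset.Icc (1 : ℤ) k) {Tb Ta : ℕ → ℂ}
    (hTb : ∀ r, SymTendsto (fun n => ee (-(n : ℂ) * (r₂ : ℂ) / (k : ℂ)) / (twoPiI n) ^ (r + 1) *
      ∑ m ∈ S, (m : ℂ) ^ r * ee ((n : ℂ) * (b : ℂ) / ((m : ℂ) * (k : ℂ)))) (Tb r))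
    (hTa : ∀ r, SymTendsto (fun n => ee (-(n : ℂ) * (r₂ : ℂ) / (k : ℂ)) / (twoPiI n) ^ (r + 1) *
      ∑ m ∈ S, (m : ℂ) ^ r * ee ((n : ℂ) * (a : ℂ) / ((m : ℂ) * (k : ℂ)))) (Ta r)) :
    ∃ J, SymTendsto (fun n => ee (-(n : ℂ) * (r₂ : ℂ) / (k : ℂ)) / (twoPiI n) ^ (R + 1) *
        ∫ u in a..b, iteratedDerivWithin (R + 1) f (Set.Icc a b) u *
          ∑ m ∈ S, (m : ℂ) ^ R * ee ((n : ℂ) * (u : ℂ) / ((m : ℂ) * (k : ℂ)))) J ∧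
      ∑ m ∈ S, ∑ l ∈ (Finset.Icc 1 ⌊b⌋).filter (fun l => l % (k : ℤ) = r₂ % (k : ℤ)),
          (Set.Ioc a b).indicator f ((m * l : ℤ) : ℝ)
        = 1 / (k : ℂ) * ((∑ m ∈ S, 1 / (m : ℂ)) * ∫ u in a..b, f u)
          + ∑ r ∈ Finset.range (R + 1), (-1 : ℂ) ^ r * (k : ℂ) ^ r *
            (iteratedDerivWithin r f (Set.Icc a b) b * Tb r
              - iteratedDerivWithin r f (Set.Icc a b) a * Ta r)
          + (-1 : ℂ) ^ (R + 1) * (k : ℂ) ^ R * J := by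
  have hc : (-1 : ℂ) ^ (R + 1) * (k : ℂ) ^ R ≠ 0 := by
    have : (k : ℂ) ≠ 0 := by exact_mod_cast (by omega : k ≠ 0)
    exact mul_ne_zero (pow_ne_zero _ (by norm_num)) (pow_ne_zero _ this)
  have hf1 : ContDiffOn ℝ 1 f (Set.Icc a b) := hf.of_le (by norm_cast; omega)
  have h1 := SymTendsto.sum S fun m hm =>
    symTendsto_progression hk ha0 hab ha hb hf1 (hS m hm) hr₂
  have h2 := SymTendsto.sum (Finset.range (R + 1)) fun r _ =>
    (((hTb r).const_mul (iteratedDerivWithin r f (Set.Icc a b) b)).sub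
      ((hTa r).const_mul (iteratedDerivWithin r f (Set.Icc a b) a))).const_mul
        ((-1 : ℂ) ^ r * (k : ℂ) ^ r)
  refine ⟨_, ((h1.sub h2).const_mul ((-1 : ℂ) ^ (R + 1) * (k : ℂ) ^ R)⁻¹).congr fun n hn => ?_, ?_⟩
  · rw [sum_mul_integral_eq hk hab hf hS hn, add_sub_cancel_left, inv_mul_cancel_left₀ hc]
  · rw [mul_inv_cancel_left₀ hc, Finset.sum_sub_distrib, Finset.sum_mul, Finset.mul_sum]
    have : ∑ m ∈ S, 1 / ((m : ℂ) * k) * ∫ u in a..b, f u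
        = ∑ m ∈ S, 1 / (k : ℂ) * (1 / (m : ℂ) * ∫ u in a..b, f u) :=
      Finset.sum_congr rfl fun m _ => by rw [one_div_mul_eq_div, one_div, one_div]; ring
    rw [this]
    ring

/-- Euler–Maclaurin analogue for the divisor function with a periodic weight
(Theorem 1(III)). -/
theorem euler_maclaurin_divisor_periodic_weight
    (k : ℕ) (hk : 1 ≤ k) (χ : ℤ → ℂ) (hχ : ∀ n : ℤ, χ (n + (k : ℤ)) = χ n)
    (R : ℕ) (a b : ℝ) (ha0 : 0 ≤ a) (hab : a < b)
    (ha : ∀ n : ℤ, a ≠ (n : ℝ)) (hb : ∀ n : ℤ, b ≠ (n : ℝ))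
    (f : ℝ → ℂ) (hf : ContDiffOn ℝ (R + 1) f (Set.Icc a b)) :
    ∃ Tb Ta : ℕ → ℤ → ℤ → ℂ, ∃ J : ℤ → ℤ → ℂ,
      (∀ r, r ≤ R → ∀ r₁ ∈ Finset.Icc (1 : ℤ) (k : ℤ), ∀ r₂ ∈ Finset.Icc (1 : ℤ) (k : ℤ),
        SymTendsto
          (fun n => ee (-(n : ℂ) * (r₂ : ℂ) / (k : ℂ)) / (twoPiI n) ^ (r + 1) *
            ∑ m ∈ (Finset.Icc (1 : ℤ) ⌊b⌋).filter (fun m => m % (k : ℤ) = r₁ % (k : ℤ)),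
              (m : ℂ) ^ r * ee ((n : ℂ) * (b : ℂ) / ((m : ℂ) * (k : ℂ))))
          (Tb r r₁ r₂)) ∧
      (∀ r, r ≤ R → ∀ r₁ ∈ Finset.Icc (1 : ℤ) (k : ℤ), ∀ r₂ ∈ Finset.Icc (1 : ℤ) (k : ℤ),
        SymTendsto
          (fun n => ee (-(n : ℂ) * (r₂ : ℂ) / (k : ℂ)) / (twoPiI n) ^ (r + 1) *
            ∑ m ∈ (Finset.Icc (1 : ℤ) ⌊b⌋).filter (fun m => m % (k : ℤ) = r₁ % (k : ℤ)),
              (m : ℂ) ^ r * ee ((n : ℂ) * (a : ℂ) / ((m : ℂ) * (k : ℂ))))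
          (Ta r r₁ r₂)) ∧
      (∀ r₁ ∈ Finset.Icc (1 : ℤ) (k : ℤ), ∀ r₂ ∈ Finset.Icc (1 : ℤ) (k : ℤ),
        SymTendsto
          (fun n => ee (-(n : ℂ) * (r₂ : ℂ) / (k : ℂ)) / (twoPiI n) ^ (R + 1) *
            ∫ u in a..b, iteratedDerivWithin (R + 1) f (Set.Icc a b) u *
              ∑ m ∈ (Finset.Icc (1 : ℤ) ⌊b⌋).filter (fun m => m % (k : ℤ) = r₁ % (k : ℤ)),
                (m : ℂ) ^ R * ee ((n : ℂ) * (u : ℂ) / ((m : ℂ) * (k : ℂ))))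
          (J r₁ r₂)) ∧
      ∑ n ∈ Finset.Ioc ⌊a⌋ ⌊b⌋, χ n * (n.toNat.divisors.card : ℂ) * f (n : ℝ)
        = (1 / (k : ℂ)) * (∑ r₁ ∈ Finset.Icc (1 : ℤ) (k : ℤ),
              ∑ r₂ ∈ Finset.Icc (1 : ℤ) (k : ℤ), χ (r₁ * r₂) *
                ((∑ m ∈ (Finset.Icc (1 : ℤ) ⌊b⌋).filter
                    (fun m => m % (k : ℤ) = r₁ % (k : ℤ)), 1 / (m : ℂ)) *
                  (∫ u in a..b, f u)))
          + (∑ r ∈ Finset.range (R + 1), (-1 : ℂ) ^ r * (k : ℂ) ^ r *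
              ∑ r₁ ∈ Finset.Icc (1 : ℤ) (k : ℤ), ∑ r₂ ∈ Finset.Icc (1 : ℤ) (k : ℤ),
                χ (r₁ * r₂) *
                  (iteratedDerivWithin r f (Set.Icc a b) b * Tb r r₁ r₂
                    - iteratedDerivWithin r f (Set.Icc a b) a * Ta r r₁ r₂))
          + (-1 : ℂ) ^ (R + 1) * (k : ℂ) ^ R *
              ∑ r₁ ∈ Finset.Icc (1 : ℤ) (k : ℤ), ∑ r₂ ∈ Finset.Icc (1 : ℤ) (k : ℤ),
                χ (r₁ * r₂) * J r₁ r₂ := by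
  have hS : ∀ r₁ : ℤ, ∀ m ∈ (Finset.Icc (1 : ℤ) ⌊b⌋).filter
      (fun m => m % (k : ℤ) = r₁ % (k : ℤ)), 1 ≤ m := fun r₁ m hm =>
    (Finset.mem_Icc.1 (Finset.mem_filter.1 hm).1).1
  choose Tb hTb using fun (r : ℕ) (r₁ r₂ : ℤ) => exists_symTendsto_boundary hk (hS r₁) hb r r₂
  choose Ta hTa using fun (r : ℕ) (r₁ r₂ : ℤ) => exists_symTendsto_boundary hk (hS r₁) ha r r₂
  choose! J hJ hJeq using fun (r₁ r₂ : ℤ) (hr₂ : r₂ ∈ Finset.Icc (1 : ℤ) k) =>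
    symTendsto_remainder hk ha0 hab ha hb hf (hS r₁) hr₂
      (fun r => hTb r r₁ r₂) (fun r => hTa r r₁ r₂)
  refine ⟨Tb, Ta, J, fun r _ r₁ _ r₂ _ => hTb r r₁ r₂, fun r _ r₁ _ r₂ _ => hTa r r₁ r₂,
    fun r₁ _ r₂ hr₂ => hJ r₁ r₂ hr₂, ?_⟩
  have hmem : ∀ x : ℤ, x ∈ Finset.Ioc ⌊a⌋ ⌊b⌋ ↔ (x : ℝ) ∈ Set.Ioc a b := fun x => by
    rw [Finset.mem_Ioc, Int.floor_lt, Int.le_floor, Set.mem_Ioc]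
  have hsum := sum_weight_mul_card_divisors_eq hk (χ := χ) hχ (Int.floor_nonneg.2 ha0) (A := ⌊b⌋)
    (F := fun x : ℤ => (Set.Ioc a b).indicator f (x : ℝ))
    (fun x hx => (hmem x).2 (Set.mem_of_indicator_ne_zero hx))
  rw [Finset.sum_congr rfl fun n hn => by rw [Set.indicator_of_mem ((hmem n).1 hn)]] at hsum
  rw [hsum, Finset.sum_congr rfl fun r₁ _ => Finset.sum_congr rfl fun r₂ hr₂ => by
    rw [hJeq r₁ r₂ hr₂, mul_add, mul_add]]
  simp_rw [Finset.sum_add_distrib]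
  congr 1
  · congr 1
    · rw [Finset.mul_sum]
      refine Finset.sum_congr rfl fun r₁ _ => ?_
      rw [Finset.mul_sum]
      exact Finset.sum_congr rfl fun r₂ _ => by ring
    · simp_rw [Finset.mul_sum]
      rw [Finset.sum_comm (s := Finset.range (R + 1))]
      refine Finset.sum_congr rfl fun r₁ _ => ?_
      rw [Finset.sum_comm (s := Finset.range (R + 1))]
      exact Finset.sum_congr rfl fun r₂ _ => Finset.sum_congr rfl fun r _ => by ring
  · rw [Finset.mul_sum]
    refine Finset.sum_congr rfl fun r₁ _ => ?_
    rw [Finset.mul_sum]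
    exact Finset.sum_congr rfl fun r₂ _ => by ring
end
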